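/- arXiv:1402.3142 — 4 statements merged into one kernel-verified Lean document; each statement's English description precedes it below -/
import Mathlib

section
/- Let C be a class of (finite simple) graphs such that lim_{r→∞} log(Ex_C(r))/r = 0. Then for every real ε > 0 there is an integer g such that every graph G ∈ C with girth at least g has circular chromatic number χ_c(G) ≤ 2 + ε. -/
open SimpleGraph ENNReal

universe u

/-- `H` is a shallow minor of `G` at depth `r`: there are pairwise disjoint branch sets
`A i ⊆ V(G)`, each inducing a connected subgraph of radius at most `r` (witnessed by a
center joined to every vertex of the branch set by a walk of length at most `r` inside it),
such that adjacency in `H` is witnessed by an edge of `G` between the branch sets. -/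
def SimpleGraph.IsShallowMinor {V : Type u} (G : SimpleGraph V) (r : ℕ)
    {h : ℕ} (H : SimpleGraph (Fin h)) : Prop :=
  ∃ A : Fin h → Set V,
    (Pairwise fun i j => Disjoint (A i) (A j)) ∧
    (∀ i, ∃ c : A i, ∀ v : A i, ∃ w : (G.induce (A i)).Walk c v, w.length ≤ r) ∧
    (∀ i j, H.Adj i j → ∃ a ∈ A i, ∃ b ∈ A j, G.Adj a b)

/-- The grad (greatest reduced average density) `∇_r(G)`: supremum of `‖H‖/|H|` over the
shallow minors `H` of `G` at depth `r`. -/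
noncomputable def SimpleGraph.nabla {V : Type u} (G : SimpleGraph V) (r : ℕ) : ℝ≥0∞ :=
  sSup {x : ℝ≥0∞ | ∃ (h : ℕ) (H : SimpleGraph (Fin h)), 0 < h ∧ G.IsShallowMinor r H ∧
    x = (Nat.card H.edgeSet : ℝ≥0∞) / (h : ℝ≥0∞)}

/-- A class of finite simple graphs, presented as a set of graphs on `Fin n` for varying `n`. -/
abbrev GraphClass : Type := Set ((n : ℕ) × SimpleGraph (Fin n))

/-- The expansion `Ex_C(r) = sup { ∇_r(G) : G ∈ C }` of a class of graphs. -/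
noncomputable def GraphClass.expansion (C : GraphClass) (r : ℕ) : ℝ≥0∞ :=
  sSup {x : ℝ≥0∞ | ∃ G ∈ C, x = SimpleGraph.nabla G.2 r}

/-- Iterated deletion of internal vertices of long induced-degree-two paths, ending in a
forest.  `PathDegen G p H` means the subgraph `H` of `G` can be reduced to a forest by
repeatedly deleting the internal vertices (all of degree two) of a path of length at
least `p`. -/
inductive SimpleGraph.PathDegen {V : Type u} (G : SimpleGraph V) (p : ℕ) : G.Subgraph → Prop
  | forest (H : G.Subgraph) (hH : H.coe.IsAcyclic) : PathDegen G p H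
  | step (H : G.Subgraph) (l : List V) (hnd : l.Nodup)
      (hchain : l.Chain' H.Adj) (hlen : p + 1 ≤ l.length)
      (hdeg : ∀ v ∈ l.tail.dropLast, (H.neighborSet v).ncard = 2)
      (hrec : PathDegen G p (H.deleteVerts {v | v ∈ l.tail.dropLast})) :
      PathDegen G p H

/-- A graph is `p`-path degenerate if it can be reduced to a forest by repeatedly deleting
the internal vertices, all of degree two, of paths of length at least `p`. -/
def SimpleGraph.IsPathDegenerate {V : Type u} (G : SimpleGraph V) (p : ℕ) : Prop :=
  G.PathDegen p ⊤

/-- A circular `(n,k)`-coloring: a map to `ℤ_n` sending adjacent vertices to elements at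
circular distance at least `k`. -/
def SimpleGraph.IsCircularColoring {V : Type u} (G : SimpleGraph V) (n k : ℕ) : Prop :=
  ∃ f : V → ZMod n, ∀ u v, G.Adj u v → k ≤ (f u - f v).val ∧ (f u - f v).val ≤ n - k

/-- The circular chromatic number: the infimum of the rationals `n/k` such that `G` has a
circular `(n,k)`-coloring. -/
noncomputable def SimpleGraph.circChromNum {V : Type u} (G : SimpleGraph V) : ℝ :=
  sInf {x : ℝ | ∃ n k : ℕ, 0 < n ∧ 0 < k ∧ G.IsCircularColoring n k ∧ x = (n : ℝ) / (k : ℝ)}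

/-- `o` is an orientation of `G`: every arc of `o` is an edge of `G`, and every edge of `G`
gets exactly one of its two possible directions. -/
def SimpleGraph.IsOrientation {V : Type u} (G : SimpleGraph V) (o : V → V → Prop) : Prop :=
  (∀ u v, o u v → G.Adj u v) ∧ (∀ u v, G.Adj u v → (o u v ↔ ¬ o v u))

/-- The oriented chromatic number: the least `k` such that every orientation of `G` admits a
homomorphism into some loopless digraph on `k` vertices. -/
noncomputable def SimpleGraph.orientedChromNum {V : Type u} (G : SimpleGraph V) : ℕ :=
  sInf {k : ℕ | ∀ o : V → V → Prop, G.IsOrientation o →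
    ∃ D : Fin k → Fin k → Prop, Irreflexive D ∧
      ∃ f : V → Fin k, ∀ u v, o u v → D (f u) (f v)}

/-- The circulant digraph `C⃗_n^d`: vertex set `ℤ_n`, with an arc `(i,j)` whenever
`j - i ∈ {1, …, d}` (mod `n`). -/
def circulantDigraph (n d : ℕ) : ZMod n → ZMod n → Prop :=
  fun i j => ∃ s : ℕ, 1 ≤ s ∧ s ≤ d ∧ j - i = (s : ZMod n)

/-- Tree-depth of `G`: the minimum height of a rooted forest (encoded as a strict partial
order on the vertices in which the set of strict ancestors of any vertex is a chain) all of
whose chains have at most `k` vertices, such that every edge of `G` joins two comparable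
vertices. -/
noncomputable def SimpleGraph.treeDepth {V : Type u} [Fintype V] (G : SimpleGraph V) : ℕ :=
  sInf {k : ℕ | ∃ lt : V → V → Prop, Transitive lt ∧ Irreflexive lt ∧
    (∀ x y z, lt x z → lt y z → (lt x y ∨ lt y x ∨ x = y)) ∧
    (∀ u v, G.Adj u v → lt u v ∨ lt v u) ∧
    (∀ s : Finset V, (∀ x ∈ s, ∀ y ∈ s, x = y ∨ lt x y ∨ lt y x) → s.card ≤ k)}

/-- The `p`-th chromatic number `χ_p(G)`: the least `N` such that `G` has a vertex coloring
with `N` colors in which, for every `i ≤ p`, the union of any `i` color classes induces a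
subgraph of tree-depth at most `i`. -/
noncomputable def SimpleGraph.chiP {V : Type u} [Fintype V] (G : SimpleGraph V) (p : ℕ) : ℕ :=
  sInf {N : ℕ | ∃ c : V → Fin N, ∀ i : ℕ, i ≤ p → ∀ s : Finset (Fin N), s.card = i →
    (G.induce {v | c v ∈ s}).treeDepth ≤ i}

/-- A `p`-centered coloring: every connected induced subgraph either has a color appearing
exactly once in it, or receives at least `p` distinct colors. -/
def SimpleGraph.IsCenteredColoring {V : Type u} (G : SimpleGraph V) (p : ℕ)
    {N : ℕ} (c : V → Fin N) : Prop :=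
  ∀ s : Set V, (G.induce s).Connected →
    (∃ col : Fin N, {v ∈ s | c v = col}.ncard = 1) ∨ p ≤ (c '' s).ncard

/-- `H` is a minor of `G`: there are pairwise disjoint branch sets, each inducing a
connected subgraph of `G`, such that adjacency in `H` is witnessed by an edge of `G`
between the corresponding branch sets. -/
def SimpleGraph.IsMinor {V : Type u} (G : SimpleGraph V) {h : ℕ} (H : SimpleGraph (Fin h)) : Prop :=
  ∃ A : Fin h → Set V,
    (Pairwise fun i j => Disjoint (A i) (A j)) ∧
    (∀ i, (G.induce (A i)).Connected) ∧
    (∀ i j, H.Adj i j → ∃ a ∈ A i, ∃ b ∈ A j, G.Adj a b)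

/-- A minor-closed class of graphs. -/
def GraphClass.MinorClosed (C : GraphClass) : Prop :=
  ∀ G ∈ C, ∀ (h : ℕ) (H : SimpleGraph (Fin h)), (Sigma.snd G).IsMinor H → ⟨h, H⟩ ∈ C

/-- The clique-grad `ω_r(G)`: the maximum clique number over the shallow minors of `G`
at depth `r`. -/
noncomputable def SimpleGraph.omegaMinor {V : Type u} (G : SimpleGraph V) (r : ℕ) : ℕ :=
  sSup {k : ℕ | ∃ (h : ℕ) (H : SimpleGraph (Fin h)), G.IsShallowMinor r H ∧
    ∃ s : Finset (Fin h), H.IsNClique k s}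

namespace SimpleGraph

section Distance

variable {V : Type u} {G : SimpleGraph V}

lemma Walk.isPath_of_length_eq_edist {u v : V} (p : G.Walk u v)
    (hp : (p.length : ℕ∞) = G.edist u v) : p.IsPath := by
  apply p.isPath_of_length_eq_dist
  rw [SimpleGraph.dist, ← hp]
  simp

lemma Walk.IsPath.eq_of_length_add_lt_egirth {u v : V} {p q : G.Walk u v} (hp : p.IsPath)
    (hq : q.IsPath) (h : ((p.length + q.length : ℕ) : ℕ∞) < G.egirth) : p = q := by
  by_contra hne
  obtain ⟨w, -, -, c, hc, hl⟩ := hp.exists_isCycle_length_le_add_of_ne hq hne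
  exact ((egirth_le_length hc).trans (Nat.cast_le.mpr hl)).not_gt h

/-- A vertex on a geodesic splits its length additively. -/
lemma edist_add_edist_le_of_mem_support {u v x : V} (p : G.Walk u v) (hx : x ∈ p.support) :
    G.edist u x + G.edist x v ≤ p.length := by
  classical
  have h1 := edist_le (p.takeUntil x hx)
  have h2 := edist_le (p.dropUntil x hx)
  refine (add_le_add h1 h2).trans ?_
  rw [← Nat.cast_add, ← Walk.length_append, Walk.take_spec]

lemma edist_le_add_one_of_adj {z x y : V} (h : G.Adj x y) : G.edist z y ≤ G.edist z x + 1 := by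
  rw [← edist_eq_one_iff_adj.mpr h]
  exact SimpleGraph.edist_triangle

lemma exists_coe_of_adj_of_edist {z x y : V} {j : ℕ} (h : G.Adj x y) (hx : G.edist z x = j) :
    ∃ m : ℕ, G.edist z y = m ∧ m ≤ j + 1 ∧ j ≤ m + 1 := by
  have h1 := edist_le_add_one_of_adj (z := z) h
  have h2 := edist_le_add_one_of_adj (z := z) h.symm
  rw [hx] at h1 h2
  have hne : G.edist z y ≠ ⊤ := ne_top_of_le_ne_top (by simp) h1
  obtain ⟨m, hm⟩ := ENat.ne_top_iff_exists.mp hne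
  refine ⟨m, hm.symm, ?_, ?_⟩
  · rw [← hm] at h1; exact_mod_cast h1
  · rw [← hm] at h2; exact_mod_cast h2

/-- Up to less than half the girth, adjacent vertices are never at the same distance from `z`. -/
lemma edist_ne_of_adj {z x y : V} {j : ℕ} (hg : ((2 * j + 1 : ℕ) : ℕ∞) < G.egirth)
    (h : G.Adj x y) (hx : G.edist z x = j) : G.edist z y ≠ j := by
  intro hy
  obtain ⟨p, hp⟩ := exists_walk_of_edist_eq_coe hx
  obtain ⟨q, hq⟩ := exists_walk_of_edist_eq_coe hy
  have hpp : p.IsPath := p.isPath_of_length_eq_edist (by rw [hp, hx])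
  have hqp : q.IsPath := q.isPath_of_length_eq_edist (by rw [hq, hy])
  have hyp : y ∉ p.support := by
    intro hmem
    have h1 := edist_add_edist_le_of_mem_support p hmem
    have h2 := edist_pos_of_ne (G := G) h.ne'
    rw [hp, hy] at h1
    have h3 : G.edist y x = 0 := by
      have : (j : ℕ∞) + G.edist y x ≤ j + 0 := by simpa using h1
      exact le_antisymm ((ENat.add_le_add_iff_left (ENat.natCast_ne_top j)).mp this) bot_le
    exact h2.ne' h3
  have := (hpp.concat hyp h).eq_of_length_add_lt_egirth hqp (by
    rw [Walk.length_concat, hp, hq]; convert hg using 2; ring)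
  have := congrArg Walk.length this
  rw [Walk.length_concat, hp, hq] at this
  omega

/-- Up to half the girth, a vertex has at most one neighbor closer to `z`. -/
lemma eq_of_adj_of_edist_eq {z x y y' : V} {j : ℕ} (hg : ((2 * j + 2 : ℕ) : ℕ∞) < G.egirth)
    (hx : G.edist z x = (j + 1 : ℕ)) (hy : G.edist z y = j) (hy' : G.edist z y' = j)
    (h : G.Adj y x) (h' : G.Adj y' x) : y = y' := by
  obtain ⟨p, hp⟩ := exists_walk_of_edist_eq_coe hy
  obtain ⟨q, hq⟩ := exists_walk_of_edist_eq_coe hy'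
  have hpp : (p.concat h).IsPath := Walk.isPath_of_length_eq_edist _ (by simp [hp, hx])
  have hqp : (q.concat h').IsPath := Walk.isPath_of_length_eq_edist _ (by simp [hq, hx])
  have := hpp.eq_of_length_add_lt_egirth hqp (by
    simp only [Walk.length_concat, hp, hq]; convert hg using 2; ring)
  rw [← Walk.penultimate_concat p h, this, Walk.penultimate_concat]

end Distance

section Growth

open scoped Classical

variable {V : Type u} [Fintype V] {G : SimpleGraph V}

/-- The vertices at distance exactly `j` from `z`. -/
noncomputable def sphere (G : SimpleGraph V) (z : V) (j : ℕ) : Finset V :=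
  {x | G.edist z x = j}

@[simp] lemma mem_sphere {z x : V} {j : ℕ} : x ∈ G.sphere z j ↔ G.edist z x = j := by
  simp [sphere]

lemma card_neighborFinset_inter_sphere_le_one {z x : V} {j : ℕ}
    (hg : ((2 * j + 2 : ℕ) : ℕ∞) < G.egirth) (hx : G.edist z x = (j + 1 : ℕ)) :
    (G.neighborFinset x ∩ G.sphere z j).card ≤ 1 := by
  rw [Finset.card_le_one]
  intro a ha b hb
  simp only [Finset.mem_inter, mem_neighborFinset, mem_sphere] at ha hb
  exact eq_of_adj_of_edist_eq hg hx ha.2 hb.2 ha.1.symm hb.1.symm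

lemma degree_le_card_children {z x : V} {j : ℕ} (hg : ((2 * j + 2 : ℕ) : ℕ∞) < G.egirth)
    (hx : G.edist z x = j) :
    G.degree x ≤ (if j = 0 then 0 else 1) + (G.neighborFinset x ∩ G.sphere z (j + 1)).card := by
  have hg1 : ((2 * j + 1 : ℕ) : ℕ∞) < G.egirth :=
    lt_of_le_of_lt (Nat.cast_le.mpr (by omega)) hg
  rcases j with _ | j
  · have : G.neighborFinset x ⊆ G.neighborFinset x ∩ G.sphere z (0 + 1) := by
      intro y hy
      have hxy : G.Adj x y := by simpa using hy
      obtain ⟨m, hm, h1, h2⟩ := exists_coe_of_adj_of_edist hxy hx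
      have h3 := edist_ne_of_adj hg1 hxy hx
      rw [hm] at h3
      have h4 : m ≠ 0 := by exact_mod_cast h3
      have : m = 0 + 1 := by omega
      simp only [Finset.mem_inter, hy, true_and, mem_sphere]
      rw [hm, this]
    simpa using Finset.card_le_card this
  · have : G.neighborFinset x ⊆
        (G.neighborFinset x ∩ G.sphere z j) ∪ (G.neighborFinset x ∩ G.sphere z (j + 1 + 1)) := by
      intro y hy
      have hxy : G.Adj x y := by simpa using hy
      obtain ⟨m, hm, h1, h2⟩ := exists_coe_of_adj_of_edist hxy hx
      have h3 := edist_ne_of_adj hg1 hxy hx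
      rw [hm] at h3
      have h4 : m ≠ j + 1 := by exact_mod_cast h3
      simp only [Finset.mem_union, Finset.mem_inter, hy, true_and, mem_sphere, hm]
      have : m = j ∨ m = j + 1 + 1 := by omega
      rcases this with rfl | rfl <;> simp
    refine (Finset.card_le_card this).trans ((Finset.card_union_le _ _).trans ?_)
    rw [if_neg (by omega)]
    have := card_neighborFinset_inter_sphere_le_one (z := z) (x := x) (j := j)
      (lt_of_le_of_lt (Nat.cast_le.mpr (by omega)) hg) hx
    omega

lemma card_sphere_add_sum_le {z : V} {j : ℕ} (hg : ((2 * j + 2 : ℕ) : ℕ∞) < G.egirth)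
    (hdeg : ∀ x, 2 ≤ G.degree x) :
    (G.sphere z j).card + ∑ x ∈ G.sphere z j, (G.degree x - 2) ≤ (G.sphere z (j + 1)).card := by
  have hdisj : ((G.sphere z j : Finset V) : Set V).PairwiseDisjoint
      (fun x => G.neighborFinset x ∩ G.sphere z (j + 1)) := by
    intro a ha b hb hab
    rw [Function.onFun, Finset.disjoint_left]
    intro y hy hy'
    simp only [Finset.mem_coe, mem_sphere, Finset.mem_inter, mem_neighborFinset] at ha hb hy hy'
    exact hab (eq_of_adj_of_edist_eq hg hy.2 ha hb hy.1 hy'.1)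
  have hsub : (G.sphere z j).biUnion (fun x => G.neighborFinset x ∩ G.sphere z (j + 1)) ⊆
      G.sphere z (j + 1) :=
    Finset.biUnion_subset.mpr fun x _ => Finset.inter_subset_right
  refine le_trans ?_ (Finset.card_le_card hsub)
  rw [Finset.card_biUnion hdisj, Finset.card_eq_sum_ones, ← Finset.sum_add_distrib]
  refine Finset.sum_le_sum fun x hx => ?_
  have h1 := degree_le_card_children hg (mem_sphere.mp hx)
  have h2 := hdeg x
  split_ifs at h1 <;> omega

lemma one_add_sum_le_card_sphere {z : V} {j : ℕ} (hg : ((2 * j : ℕ) : ℕ∞) < G.egirth)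
    (hdeg : ∀ x, 2 ≤ G.degree x) :
    1 + ∑ i ∈ Finset.range j, ∑ x ∈ G.sphere z i, (G.degree x - 2) ≤ (G.sphere z j).card := by
  induction j with
  | zero =>
    simp only [Finset.range_zero, Finset.sum_empty, add_zero]
    exact Finset.card_pos.mpr ⟨z, by simp⟩
  | succ j ih =>
    have h1 := ih (lt_of_le_of_lt (Nat.cast_le.mpr (by omega)) hg)
    have h2 := card_sphere_add_sum_le (z := z) (j := j) hg hdeg
    rw [Finset.sum_range_succ]
    omega

/-- No path of length `p` in `G` has all its inner vertices of degree two. -/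
def NoThread (G : SimpleGraph V) (p : ℕ) : Prop :=
  ∀ s : ℕ → V, Set.InjOn s (Set.Iic p) → (∀ i < p, G.Adj (s i) (s (i + 1))) →
    ∃ i, 0 < i ∧ i < p ∧ G.degree (s i) ≠ 2

lemma card_sphere_le_sum_of_noThread {z : V} {j p : ℕ}
    (hg : ((2 * (j + p) : ℕ) : ℕ∞) < G.egirth)
    (hdeg : ∀ x, 2 ≤ G.degree x) (hT : G.NoThread p) :
    (G.sphere z j).card ≤
      ∑ i ∈ Finset.range p, ∑ x ∈ G.sphere z (j + i), (G.degree x - 2) := by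
  have hchild : ∀ x, ∃ y, ∀ m : ℕ, m < j + p → G.edist z x = m →
      G.Adj x y ∧ G.edist z y = (m + 1 : ℕ) := by
    intro x
    by_cases h : ∃ m : ℕ, m < j + p ∧ G.edist z x = m
    · obtain ⟨m, hm, hx⟩ := h
      have h1 := degree_le_card_children
        (lt_of_le_of_lt (Nat.cast_le.mpr (by omega : 2 * m + 2 ≤ 2 * (j + p))) hg) hx
      have h2 := hdeg x
      have h3 : 0 < (G.neighborFinset x ∩ G.sphere z (m + 1)).card := by
        split_ifs at h1 <;> omega
      obtain ⟨y, hy⟩ := Finset.card_pos.mp h3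
      simp only [Finset.mem_inter, mem_neighborFinset, mem_sphere] at hy
      refine ⟨y, fun m' _ hm' => ?_⟩
      have : m' = m := by rw [hx] at hm'; exact_mod_cast hm'.symm
      exact this ▸ hy
    · exact ⟨x, fun m hm hx => absurd ⟨m, hm, hx⟩ h⟩
  choose ch hch using hchild
  have hlev : ∀ i ≤ p, ∀ x ∈ G.sphere z j, G.edist z (ch^[i] x) = (j + i : ℕ) := by
    intro i
    induction i with
    | zero => intro _ x hx; simpa using hx
    | succ i ih =>
      intro hi x hx
      rw [Function.iterate_succ_apply']
      exact (hch _ (j + i) (by omega) (ih (by omega) x hx)).2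
  have hadj : ∀ i < p, ∀ x ∈ G.sphere z j, G.Adj (ch^[i] x) (ch^[i + 1] x) := by
    intro i hi x hx
    rw [Function.iterate_succ_apply']
    exact (hch _ (j + i) (by omega) (hlev i hi.le x hx)).1
  have hinj : ∀ i ≤ p, Set.InjOn (ch^[i]) (G.sphere z j : Finset V) := by
    intro i
    induction i with
    | zero => intro _ x _ y _ h; simpa using h
    | succ i ih =>
      intro hi x hx y hy h
      refine ih (by omega) hx hy ?_
      have hx' := hadj i (by omega) x hx
      rw [h] at hx'
      exact eq_of_adj_of_edist_eq
        (lt_of_le_of_lt (Nat.cast_le.mpr (by omega : 2 * (j + i) + 2 ≤ 2 * (j + p))) hg)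
        (hlev (i + 1) hi y hy) (hlev i (by omega) x hx) (hlev i (by omega) y hy) hx'
        (hadj i (by omega) y hy)
  have hbranch : ∀ x ∈ G.sphere z j,
      1 ≤ ∑ i ∈ Finset.range p, (G.degree (ch^[i] x) - 2) := by
    intro x hx
    obtain ⟨i, _, hip, hi⟩ := hT (fun i => ch^[i] x) (by
      intro a ha b hb hab
      have h1 := hlev a ha x hx
      simp only at hab
      rw [hab, hlev b hb x hx] at h1
      have : j + b = j + a := by exact_mod_cast h1
      omega) (fun i hi => hadj i hi x hx)
    have h2 := hdeg (ch^[i] x)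
    refine le_trans ?_ (Finset.single_le_sum (f := fun i => G.degree (ch^[i] x) - 2)
      (fun _ _ => Nat.zero_le _) (Finset.mem_range.mpr hip))
    have hi' : G.degree (ch^[i] x) ≠ 2 := hi
    change 1 ≤ G.degree (ch^[i] x) - 2
    omega
  calc (G.sphere z j).card = ∑ x ∈ G.sphere z j, 1 := Finset.card_eq_sum_ones _
    _ ≤ ∑ x ∈ G.sphere z j, ∑ i ∈ Finset.range p, (G.degree (ch^[i] x) - 2) :=
        Finset.sum_le_sum hbranch
    _ = ∑ i ∈ Finset.range p, ∑ x ∈ G.sphere z j, (G.degree (ch^[i] x) - 2) := Finset.sum_comm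
    _ ≤ _ := by
        refine Finset.sum_le_sum fun i hi => ?_
        have hi' := (Finset.mem_range.mp hi).le
        rw [← Finset.sum_image (f := fun y => G.degree y - 2) (hinj i hi')]
        refine Finset.sum_le_sum_of_subset fun y hy => ?_
        obtain ⟨x, hx, rfl⟩ := Finset.mem_image.mp hy
        exact mem_sphere.mpr (hlev i hi' x hx)

/-- The total excess of the degrees over two grows exponentially with the radius. -/
lemma two_pow_le_one_add_sum {z : V} {n p : ℕ} (hg : ((2 * (n * p) : ℕ) : ℕ∞) < G.egirth)
    (hdeg : ∀ x, 2 ≤ G.degree x) (hT : G.NoThread p) :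
    2 ^ n ≤ 1 + ∑ i ∈ Finset.range (n * p), ∑ x ∈ G.sphere z i, (G.degree x - 2) := by
  induction n with
  | zero => simp
  | succ n ih =>
    have hle : 2 * (n * p) ≤ 2 * ((n + 1) * p) := by gcongr; omega
    have hg' := lt_of_le_of_lt (Nat.cast_le.mpr hle) hg
    have h1 := ih hg'
    have h2 := one_add_sum_le_card_sphere (z := z) hg' hdeg
    have h3 := card_sphere_le_sum_of_noThread (z := z) (j := n * p) (p := p)
      (by rwa [← Nat.succ_mul]) hdeg hT
    rw [Nat.succ_mul, Finset.sum_range_add, pow_succ]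
    omega

/-- The total excess of the degrees over two in any set containing a large ball is large. -/
lemma two_pow_le_one_add_sum_of_ball_subset {z : V} {n p : ℕ} {A : Finset V}
    (hA : ∀ x, G.edist z x ≤ (n * p : ℕ) → x ∈ A)
    (hg : ((2 * (n * p) : ℕ) : ℕ∞) < G.egirth)
    (hdeg : ∀ x, 2 ≤ G.degree x) (hT : G.NoThread p) :
    2 ^ n ≤ 1 + ∑ x ∈ A, (G.degree x - 2) := by
  refine (two_pow_le_one_add_sum (z := z) hg hdeg hT).trans (Nat.add_le_add_left ?_ 1)
  rw [← Finset.sum_biUnion]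
  · refine Finset.sum_le_sum_of_subset fun x hx => ?_
    obtain ⟨i, hi, hx⟩ := Finset.mem_biUnion.mp hx
    refine hA x ?_
    rw [mem_sphere.mp hx]
    exact Nat.cast_le.mpr (Finset.mem_range.mp hi).le
  · intro a _ b _ hab
    rw [Function.onFun, Finset.disjoint_left]
    intro x hx hx'
    rw [mem_sphere] at hx hx'
    rw [hx] at hx'
    exact hab (by exact_mod_cast hx')

end Growth

section Voronoi

variable {V : Type u} {G : SimpleGraph V}

lemma exists_maximal_separated [Finite V] (G : SimpleGraph V) (N : ℕ∞) :
    ∃ Z : Set V, (∀ a ∈ Z, ∀ b ∈ Z, a ≠ b → N < G.edist a b) ∧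
      ∀ x, ∃ z ∈ Z, G.edist z x ≤ N := by
  obtain ⟨Z, hZ⟩ := (Set.toFinite
    {Z : Set V | ∀ a ∈ Z, ∀ b ∈ Z, a ≠ b → N < G.edist a b}).exists_maximal ⟨∅, by simp⟩
  refine ⟨Z, hZ.prop, fun x => ?_⟩
  by_contra! hx
  have hxZ : x ∉ Z := fun h => by simpa using hx x h
  refine hxZ (hZ.le_of_ge (y := insert x Z) ?_ (Set.subset_insert x Z) (Set.mem_insert x Z))
  rintro a (rfl | ha) b (rfl | hb) hab
  · exact absurd rfl hab
  · rw [edist_comm]; exact hx b hb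
  · exact hx a ha
  · exact hZ.prop a ha b hb hab

/-- A partition of the vertices into cells of radius at most `2 * R` around the points of a net;
each cell contains the ball of radius `R` around its center and is closed under geodesics to the
center. -/
lemma exists_voronoi [Finite V] (G : SimpleGraph V) (R : ℕ) :
    ∃ c : V → V, (∀ x, G.edist (c x) x ≤ (2 * R : ℕ)) ∧
      (∀ x y, G.edist (c x) y ≤ R → c y = c x) ∧
      ∀ x y, G.edist (c x) y + G.edist y x ≤ G.edist (c x) x → c y = c x := by
  obtain ⟨Z, hsep, hcov⟩ := exists_maximal_separated G (2 * R : ℕ)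
  obtain ⟨m, ⟨ι⟩⟩ := Finite.exists_equiv_fin V
  have hmin : ∀ x, ∃ z ∈ Z, ∀ z' ∈ Z,
      toLex (G.edist z x, ι z) ≤ toLex (G.edist z' x, ι z') := by
    intro x
    obtain ⟨z, hz, hz'⟩ := Set.exists_min_image Z (fun z => toLex (G.edist z x, ι z))
      (Set.toFinite Z) ((hcov x).imp fun _ h => h.1)
    exact ⟨z, hz, hz'⟩
  choose c hcZ hc using hmin
  have hle : ∀ x, ∀ z ∈ Z, G.edist (c x) x ≤ G.edist z x := fun x z hz => by
    rcases Prod.Lex.le_iff.mp (hc x z hz) with h | h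
    · exact h.le
    · exact h.1.le
  refine ⟨c, fun x => ?_, fun x y h => ?_, fun x y h => ?_⟩
  · obtain ⟨z, hz, hzx⟩ := hcov x
    exact (hle x z hz).trans hzx
  · by_contra hne
    refine (hsep _ (hcZ y) _ (hcZ x) hne).not_ge ?_
    calc G.edist (c y) (c x) ≤ G.edist (c y) y + G.edist y (c x) := SimpleGraph.edist_triangle
      _ ≤ R + R := add_le_add ((hle y _ (hcZ x)).trans h) (by rwa [edist_comm])
      _ = (2 * R : ℕ) := by push_cast; ring
  · have hx : G.edist (c x) x ≠ ⊤ := by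
      obtain ⟨z, hz, hzx⟩ := hcov x
      exact ne_top_of_le_ne_top (ENat.natCast_ne_top _) ((hle x z hz).trans hzx)
    have hy : G.edist y x ≠ ⊤ := ne_top_of_le_ne_top hx (le_add_self.trans h)
    have htri : G.edist (c y) x ≤ G.edist (c y) y + G.edist y x := SimpleGraph.edist_triangle
    have h1 := hle y _ (hcZ x)
    have h2 := hle x _ (hcZ y)
    have hyx : G.edist (c y) y = G.edist (c x) y := by
      refine le_antisymm h1 ?_
      exact (ENat.add_le_add_iff_right hy).mp (h.trans (h2.trans htri))
    have hxx : G.edist (c y) x = G.edist (c x) x :=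
      le_antisymm (htri.trans (by rw [hyx]; exact h)) h2
    have h3 : ι (c y) ≤ ι (c x) := by
      rcases Prod.Lex.le_iff.mp (hc y _ (hcZ x)) with h | h
      · exact absurd hyx h.ne
      · exact h.2
    have h4 : ι (c x) ≤ ι (c y) := by
      rcases Prod.Lex.le_iff.mp (hc x _ (hcZ y)) with h | h
      · exact absurd hxx.symm h.ne
      · exact h.2
    exact ι.injective (le_antisymm h3 h4)

/-- Cells closed under geodesics to the center are connected by short paths from the center. -/
lemma exists_isPath_in_cell {c : V → V} {N : ℕ} (hrad : ∀ x, G.edist (c x) x ≤ N)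
    (hgeo : ∀ x y, G.edist (c x) y + G.edist y x ≤ G.edist (c x) x → c y = c x) (x : V) :
    ∃ w : G.Walk (c x) x, w.IsPath ∧ w.length ≤ N ∧ ∀ y ∈ w.support, c y = c x := by
  obtain ⟨w, hw⟩ := exists_walk_of_edist_ne_top
    (ne_top_of_le_ne_top (ENat.natCast_ne_top _) (hrad x))
  refine ⟨w, w.isPath_of_length_eq_edist hw, ?_, fun y hy => hgeo x y ?_⟩
  · have := hrad x
    rw [← hw] at this
    exact_mod_cast this
  · rw [← hw]
    exact edist_add_edist_le_of_mem_support w hy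

/-- In a graph of large girth, there is at most one edge between two cells. -/
lemma eq_and_eq_of_adj_between_cells {c : V → V} {N : ℕ}
    (hg : ((4 * N + 2 : ℕ) : ℕ∞) < G.egirth)
    (hcell : ∀ x, ∃ w : G.Walk (c x) x, w.IsPath ∧ w.length ≤ N ∧ ∀ y ∈ w.support, c y = c x)
    {z z' a b a' b' : V} (hne : z ≠ z') (ha : c a = z) (hb : c b = z') (ha' : c a' = z)
    (hb' : c b' = z') (hab : G.Adj a b) (hab' : G.Adj a' b') : a = a' ∧ b = b' := by
  have key : ∀ a b, c a = z → c b = z' → G.Adj a b → ∃ w : G.Walk z z', w.IsPath ∧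
      w.length ≤ 2 * N + 1 ∧ s(a, b) ∈ w.edges ∧
      ∀ x y, c x = z → c y = z' → s(x, y) ∈ w.edges → x = a ∧ y = b := by
    rintro a b rfl rfl hab
    obtain ⟨p, hp, hpl, hps⟩ := hcell a
    obtain ⟨q, hq, hql, hqs⟩ := hcell b
    refine ⟨p.append (Walk.cons hab q.reverse), ?_, ?_, by simp, ?_⟩
    · rw [Walk.isPath_def, Walk.support_append]
      simp only [Walk.support_cons, List.tail_cons, Walk.support_reverse]
      rw [List.nodup_append]
      refine ⟨hp.support_nodup, List.nodup_reverse.mpr hq.support_nodup, ?_⟩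
      intro x hx y hy hxy
      rw [List.mem_reverse] at hy
      exact hne (by rw [← hps x hx, hxy, hqs y hy])
    · simp only [Walk.length_append, Walk.length_cons, Walk.length_reverse]
      omega
    · intro x y hx hy hxy
      simp only [Walk.edges_append, Walk.edges_cons, Walk.edges_reverse, List.mem_append,
        List.mem_cons, List.mem_reverse] at hxy
      rcases hxy with h | h | h
      · exact absurd ((hps y (p.snd_mem_support_of_mem_edges h)).symm.trans hy) hne
      · rcases Sym2.eq_iff.mp h with h | ⟨rfl, rfl⟩
        · exact h
        · exact absurd hx.symm hne
      · exact absurd (hx.symm.trans (hqs x (q.fst_mem_support_of_mem_edges h))) hne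
  obtain ⟨w, hw, hwl, hmem, -⟩ := key a b ha hb hab
  obtain ⟨w', hw', hwl', -, huniq⟩ := key a' b' ha' hb' hab'
  have heq : w = w' := hw.eq_of_length_add_lt_egirth hw'
    (lt_of_le_of_lt (Nat.cast_le.mpr (by omega)) hg)
  exact huniq a b ha hb (heq ▸ hmem)

end Voronoi

section Cells

open scoped Classical

variable {V : Type u} [Fintype V] {G : SimpleGraph V}

/-- A set of small radius in a graph of large girth spans few edges, hence sends out many. -/
lemma two_add_sum_le_sum_card_sdiff {z : V} {N : ℕ} {A : Finset V}
    (hg : ((2 * N + 2 : ℕ) : ℕ∞) < G.egirth) (hz : z ∈ A) (hA : ∀ x ∈ A, G.edist z x ≤ N)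
    (hdeg : ∀ x, 2 ≤ G.degree x) :
    2 + ∑ x ∈ A, (G.degree x - 2) ≤ ∑ x ∈ A, (G.neighborFinset x \ A).card := by
  let r : V → V → Prop := fun x y => G.Adj x y ∧ G.edist z y < G.edist z x
  have hr : ∀ x ∈ A, (A.bipartiteAbove r x).card ≤ if x = z then 0 else 1 := by
    intro x hx
    obtain ⟨m, hm⟩ := ENat.ne_top_iff_exists.mp
      (ne_top_of_le_ne_top (ENat.natCast_ne_top _) (hA x hx))
    have hmN : m ≤ N := by have := hA x hx; rw [← hm] at this; exact_mod_cast this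
    rcases m with _ | m
    · have hxz : z = x := edist_eq_zero_iff.mp hm.symm
      rw [if_pos hxz.symm, Nat.le_zero, Finset.card_eq_zero, Finset.bipartiteAbove,
        Finset.filter_eq_empty_iff]
      rintro y - ⟨-, hy⟩
      rw [← hm] at hy
      simp at hy
    · have hxz : x ≠ z := by
        rintro rfl
        simp at hm
      rw [if_neg hxz]
      refine le_trans (Finset.card_le_card ?_) (card_neighborFinset_inter_sphere_le_one
        (lt_of_le_of_lt (Nat.cast_le.mpr (by omega : 2 * m + 2 ≤ 2 * N + 2)) hg) hm.symm)
      intro y hy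
      obtain ⟨-, hxy, hlt⟩ := Finset.mem_filter.mp hy
      obtain ⟨k, hk, h1, h2⟩ := exists_coe_of_adj_of_edist hxy hm.symm
      rw [← hm, hk] at hlt
      have hlt' : k < m + 1 := by exact_mod_cast hlt
      have : k = m := by omega
      simp [hxy, hk, this]
  have hsum : ∑ x ∈ A, (A.bipartiteAbove r x).card + 1 ≤ A.card := by
    have h1 := Finset.sum_le_sum hr
    rw [← Finset.add_sum_erase A (fun x => if x = z then 0 else 1) hz, if_pos rfl, zero_add,
      Finset.sum_congr (s₂ := A.erase z) rfl (fun x hx => if_neg (Finset.ne_of_mem_erase hx)),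
      ← Finset.card_eq_sum_ones] at h1
    have := Finset.card_erase_add_one hz
    omega
  have hsum' : ∑ x ∈ A, (A.bipartiteBelow r x).card + 1 ≤ A.card := by
    rwa [← Finset.sum_card_bipartiteAbove_eq_sum_card_bipartiteBelow]
  have hdegle : ∀ x ∈ A, G.degree x ≤ (A.bipartiteAbove r x).card + (A.bipartiteBelow r x).card +
      (G.neighborFinset x \ A).card := by
    intro x hx
    have hsub : G.neighborFinset x ⊆
        (A.bipartiteAbove r x ∪ A.bipartiteBelow r x) ∪ (G.neighborFinset x \ A) := by
      intro y hy
      have hxy : G.Adj x y := by simpa using hy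
      by_cases hyA : y ∈ A
      · obtain ⟨m, hm⟩ := ENat.ne_top_iff_exists.mp
          (ne_top_of_le_ne_top (ENat.natCast_ne_top _) (hA x hx))
        have hmN : m ≤ N := by have := hA x hx; rw [← hm] at this; exact_mod_cast this
        have h1 := edist_ne_of_adj
          (lt_of_le_of_lt (Nat.cast_le.mpr (by omega : 2 * m + 1 ≤ 2 * N + 2)) hg) hxy hm.symm
        rw [hm] at h1
        apply Finset.mem_union_left
        rcases lt_or_gt_of_ne h1 with h | h
        · exact Finset.mem_union_left _ (Finset.mem_filter.mpr ⟨hyA, hxy, h⟩)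
        · exact Finset.mem_union_right _ (Finset.mem_filter.mpr ⟨hyA, hxy.symm, h⟩)
      · exact Finset.mem_union_right _ (Finset.mem_sdiff.mpr ⟨hy, hyA⟩)
    refine (Finset.card_le_card hsub).trans ((Finset.card_union_le _ _).trans ?_)
    gcongr
    exact Finset.card_union_le _ _
  have htot := Finset.sum_le_sum hdegle
  rw [Finset.sum_add_distrib, Finset.sum_add_distrib] at htot
  have hdeg2 : ∑ x ∈ A, G.degree x = ∑ x ∈ A, (G.degree x - 2) + 2 * A.card := by
    rw [mul_comm, ← smul_eq_mul, ← Finset.sum_const, ← Finset.sum_add_distrib]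
    exact Finset.sum_congr rfl fun x _ => (Nat.sub_add_cancel (hdeg x)).symm
  omega

/-- Large girth and minimum degree at least two without long threads forces dense shallow
minors. -/
theorem two_pow_le_nabla [Nonempty V] {n p : ℕ}
    (hg : ((8 * ((n + 1) * p) + 2 : ℕ) : ℕ∞) < G.egirth)
    (hdeg : ∀ x, 2 ≤ G.degree x) (hT : G.NoThread p) :
    (2 ^ n : ℝ≥0∞) ≤ G.nabla (2 * ((n + 1) * p)) := by
  obtain ⟨c, hrad, hball, hgeo⟩ := exists_voronoi G ((n + 1) * p)
  set R := (n + 1) * p with hR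
  have hcell := exists_isPath_in_cell hrad hgeo
  have hcc : ∀ x, c (c x) = c x := fun x => hball x (c x) (by simp)
  let Z : Finset V := Finset.univ.image c
  let e : Fin Z.card ≃ Z := Z.equivFin.symm
  have hZ : ∀ i, c (e i) = e i := fun i => by
    obtain ⟨x, -, hx⟩ := Finset.mem_image.mp (e i).2
    rw [← hx, hcc]
  have hcZ : ∀ x, c x ∈ Z := fun x => Finset.mem_image_of_mem c (Finset.mem_univ x)
  let H : SimpleGraph (Fin Z.card) := SimpleGraph.mk
    (fun i j => i ≠ j ∧ ∃ a b, c a = e i ∧ c b = e j ∧ G.Adj a b)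
    ⟨fun i j ⟨hij, a, b, ha, hb, hab⟩ => ⟨hij.symm, b, a, hb, ha, hab.symm⟩⟩
    ⟨fun i hi => hi.1 rfl⟩
  have hminor : G.IsShallowMinor (2 * R) H := by
    refine ⟨fun i => {x | c x = e i}, ?_, ?_, ?_⟩
    · intro i j hij
      rw [Set.disjoint_left]
      intro x hx hx'
      exact hij (e.injective (Subtype.ext (hx.symm.trans hx')))
    · intro i
      refine ⟨⟨e i, hZ i⟩, ?_⟩
      rintro ⟨v, hv⟩
      have hv' : c v = e i := hv
      have hw := hcell v
      rw [hv'] at hw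
      obtain ⟨w, -, hwl, hws⟩ := hw
      refine ⟨w.induce {x | c x = e i} hws, ?_⟩
      rw [← Walk.length_map (Embedding.induce _).toHom, Walk.map_induce]
      exact hwl
    · rintro i j ⟨-, a, b, ha, hb, hab⟩
      exact ⟨a, ha, b, hb, hab⟩
  have hHdeg : ∀ i, 2 ^ (n + 1) ≤ H.degree i := by
    intro i
    let A : Finset V := {x | c x = e i}
    have hmemA : ∀ x, x ∈ A ↔ c x = e i := fun x => by simp [A]
    have h1 : 2 ^ (n + 1) ≤ 1 + ∑ x ∈ A, (G.degree x - 2) :=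
      two_pow_le_one_add_sum_of_ball_subset (z := (e i : V)) (p := p)
        (fun x hx => (hmemA x).mpr (by
          have := hball (e i) x (by rw [hZ i]; exact hx)
          rw [this, hZ i]))
        (lt_of_le_of_lt (Nat.cast_le.mpr (by omega)) hg) hdeg hT
    have h2 := two_add_sum_le_sum_card_sdiff (z := (e i : V)) (N := 2 * R) (A := A)
      (lt_of_le_of_lt (Nat.cast_le.mpr (by omega)) hg) ((hmemA _).mpr (hZ i))
      (fun x hx => by rw [← (hmemA x).mp hx]; exact hrad x) hdeg
    have h3 : ∑ x ∈ A, (G.neighborFinset x \ A).card ≤ H.degree i := by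
      rw [← Finset.card_sigma, ← card_neighborFinset_eq_degree]
      refine Finset.card_le_card_of_injOn (fun q => e.symm ⟨c q.2, hcZ q.2⟩) ?_ ?_
      · rintro ⟨x, y⟩ hq
        simp only [Finset.coe_sigma, Set.mem_sigma_iff, Finset.mem_coe, Finset.mem_sdiff,
          mem_neighborFinset, hmemA] at hq
        simp only [Finset.mem_coe, mem_neighborFinset]
        refine ⟨fun h => hq.2.2 ?_, x, y, hq.1, by simp, hq.2.1⟩
        rw [h]; simp
      · rintro ⟨x, y⟩ hq ⟨x', y'⟩ hq' heq
        simp only [Finset.coe_sigma, Set.mem_sigma_iff, Finset.mem_coe, Finset.mem_sdiff,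
          mem_neighborFinset, hmemA] at hq hq'
        have hyy : c y = c y' := by simpa using heq
        obtain ⟨rfl, rfl⟩ := eq_and_eq_of_adj_between_cells
          (lt_of_le_of_lt (Nat.cast_le.mpr (by omega)) hg) hcell (fun h => hq.2.2 h.symm)
          hq.1 rfl hq'.1 hyy.symm hq.2.1 hq'.2.1
        rfl
    omega
  have hcard : 0 < Z.card := Finset.card_pos.mpr ((Finset.univ_nonempty).image c)
  have hedges : 2 ^ n * Z.card ≤ Nat.card H.edgeSet := by
    have h1 := H.sum_degrees_eq_twice_card_edges
    have h2 : ∑ i : Fin Z.card, 2 ^ (n + 1) ≤ ∑ i, H.degree i :=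
      Finset.sum_le_sum fun i _ => hHdeg i
    rw [Finset.sum_const, Finset.card_univ, Fintype.card_fin, smul_eq_mul] at h2
    rw [Nat.card_eq_fintype_card, ← edgeFinset_card]
    have h3 : Z.card * 2 ^ (n + 1) = 2 * (2 ^ n * Z.card) := by ring
    omega
  refine le_trans ?_ (le_sSup ⟨Z.card, H, hcard, hminor, rfl⟩)
  rw [ENNReal.le_div_iff_mul_le (Or.inl (by exact_mod_cast hcard.ne')) (Or.inl (by simp))]
  exact_mod_cast hedges

end Cells

section Coloring

variable {V : Type u} {G : SimpleGraph V}

/-- A homomorphism to the odd cycle on `ZMod (2 * k + 1)` whose edges are the pairs with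
difference `k`. -/
def HasOddCycleHom (G : SimpleGraph V) (k : ℕ) : Prop :=
  ∃ f : V → ZMod (2 * k + 1), ∀ u v, G.Adj u v → f u - f v = k ∨ f v - f u = k

lemma HasOddCycleHom.isCircularColoring {k : ℕ} (hk : 0 < k) (h : G.HasOddCycleHom k) :
    G.IsCircularColoring (2 * k + 1) k := by
  obtain ⟨f, hf⟩ := h
  refine ⟨f, fun u v huv => ?_⟩
  rcases hf u v huv with h | h
  · rw [h, ZMod.val_natCast_of_lt (by omega)]
    omega
  · have h0 : ((2 * k + 1 : ℕ) : ZMod (2 * k + 1)) = 0 := ZMod.natCast_self _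
    have h1 : f u - f v = ((k + 1 : ℕ) : ZMod (2 * k + 1)) := by
      push_cast at h0 ⊢
      linear_combination -h - h0
    rw [h1, ZMod.val_natCast_of_lt (by omega)]
    omega

open scoped Classical in
lemma HasOddCycleHom.of_degree_le_one [Fintype V] {k : ℕ} {v : V} (hv : G.degree v ≤ 1)
    (h : (G.induce {x | x ≠ v}).HasOddCycleHom k) : G.HasOddCycleHom k := by
  obtain ⟨f, hf⟩ := h
  let f' : V → ZMod (2 * k + 1) := fun x => if hx : x ≠ v then f ⟨x, hx⟩ else 0
  have hf' : ∀ x y, x ≠ v → y ≠ v → G.Adj x y → f' x - f' y = k ∨ f' y - f' x = k := by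
    intro x y hx hy hxy
    simp only [f', dif_pos hx, dif_pos hy]
    exact hf ⟨x, hx⟩ ⟨y, hy⟩ hxy
  obtain ⟨a, ha⟩ : ∃ a : ZMod (2 * k + 1), ∀ w, G.Adj v w → a - f' w = k := by
    by_cases hw : ∃ w, G.Adj v w
    · obtain ⟨w, hw⟩ := hw
      refine ⟨f' w + k, fun w' hw' => ?_⟩
      have := Finset.card_le_one.mp hv w (by simpa using hw) w' (by simpa using hw')
      rw [this]; ring
    · exact ⟨0, fun w h => absurd ⟨w, h⟩ hw⟩
  refine ⟨fun x => if x = v then a else f' x, fun x y hxy => ?_⟩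
  by_cases hx : x = v
  · subst hx
    left
    simp only [if_true, if_neg hxy.ne']
    exact ha y hxy
  · by_cases hy : y = v
    · subst hy
      right
      simp only [if_true, if_neg hx]
      exact ha x hxy.symm
    · simp only [if_neg hx, if_neg hy]
      exact hf' x y hx hy hxy

/-- Between any two vertices of the odd cycle there is a walk of length exactly `2 * k`. -/
lemma exists_walk_oddCycle (k : ℕ) (a b : ZMod (2 * k + 1)) :
    ∃ c : ℕ → ZMod (2 * k + 1), c 0 = a ∧ c (2 * k) = b ∧
      ∀ i, c (i + 1) - c i = k ∨ c i - c (i + 1) = k := by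
  have h0 : ((2 * k + 1 : ℕ) : ZMod (2 * k + 1)) = 0 := ZMod.natCast_self _
  push_cast at h0
  let j := (b - a - (2 * k : ℕ) * k).val
  have hj : j ≤ 2 * k := Nat.lt_succ_iff.mp (ZMod.val_lt _)
  refine ⟨fun i => a + i * k + (min i j : ℕ), by simp, ?_, fun i => ?_⟩
  · simp only [min_eq_right hj, j, ZMod.natCast_val, ZMod.cast_id', id]
    ring
  · rcases lt_or_ge i j with h | h
    · right
      simp only [min_eq_left h.le, min_eq_left (Nat.succ_le_of_lt h)]
      push_cast
      linear_combination -h0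
    · left
      simp only [min_eq_right h, min_eq_right (h.trans (Nat.le_succ i))]
      push_cast
      ring

open scoped Classical in
lemma HasOddCycleHom.of_thread [Fintype V] {k : ℕ} {s : ℕ → V}
    (hinj : Set.InjOn s (Set.Iic (2 * k))) (hadj : ∀ i < 2 * k, G.Adj (s i) (s (i + 1)))
    (hdeg : ∀ i, 0 < i → i < 2 * k → G.degree (s i) = 2)
    (h : (G.induce {x | ∀ i, 0 < i → i < 2 * k → x ≠ s i}).HasOddCycleHom k) :
    G.HasOddCycleHom k := by
  set S : Set V := {x | ∀ i, 0 < i → i < 2 * k → x ≠ s i} with hS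
  obtain ⟨f, hf⟩ := h
  let f' : V → ZMod (2 * k + 1) := fun x => if hx : x ∈ S then f ⟨x, hx⟩ else 0
  obtain ⟨c, hc0, hck, hc⟩ := exists_walk_oddCycle k (f' (s 0)) (f' (s (2 * k)))
  have hF : ∀ x, ∃ a : ZMod (2 * k + 1), (x ∈ S → a = f' x) ∧
      ∀ i, 0 < i → i < 2 * k → x = s i → a = c i := by
    intro x
    by_cases hx : x ∈ S
    · exact ⟨f' x, fun _ => rfl, fun i h1 h2 h3 => absurd h3 (hx i h1 h2)⟩
    · obtain ⟨i, h1, h2, h3⟩ : ∃ i, 0 < i ∧ i < 2 * k ∧ x = s i := by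
        by_contra! hcon
        exact hx hcon
      refine ⟨c i, fun h => absurd h hx, fun j hj1 hj2 hj3 => ?_⟩
      rw [hinj (Set.mem_Iic.mpr h2.le) (Set.mem_Iic.mpr hj2.le) (h3.symm.trans hj3)]
  choose F hFS hFs using hF
  have hFc : ∀ i ≤ 2 * k, F (s i) = c i := by
    intro i hi
    by_cases h1 : 0 < i ∧ i < 2 * k
    · exact hFs _ i h1.1 h1.2 rfl
    · have hmem : s i ∈ S := fun j hj1 hj2 hij => by
        have := hinj (Set.mem_Iic.mpr hi) (Set.mem_Iic.mpr hj2.le) hij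
        omega
      rw [hFS _ hmem]
      have : i = 0 ∨ i = 2 * k := by omega
      rcases this with rfl | rfl
      · exact hc0.symm
      · exact hck.symm
  have hin : ∀ i, 0 < i → i < 2 * k → ∀ y, G.Adj (s i) y → y = s (i - 1) ∨ y = s (i + 1) := by
    intro i h1 h2 y hy
    have hprev : G.Adj (s i) (s (i - 1)) := by
      have := hadj (i - 1) (by omega)
      rw [Nat.sub_add_cancel h1] at this
      exact this.symm
    have hne : s (i - 1) ≠ s (i + 1) := fun h => by
      have := hinj (Set.mem_Iic.mpr (by omega)) (Set.mem_Iic.mpr (by omega)) h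
      omega
    have hsub : ({s (i - 1), s (i + 1)} : Finset V) ⊆ G.neighborFinset (s i) := by
      intro z hz
      rcases Finset.mem_insert.mp hz with rfl | hz
      · simpa using hprev
      · rw [Finset.mem_singleton.mp hz]; simpa using hadj i h2
    have heq := Finset.eq_of_subset_of_card_le hsub (by
      rw [card_neighborFinset_eq_degree, hdeg i h1 h2, Finset.card_pair hne])
    have : y ∈ ({s (i - 1), s (i + 1)} : Finset V) := by rw [heq]; simpa using hy
    simpa using this
  have hstep : ∀ i, 0 < i → i < 2 * k → ∀ y, G.Adj (s i) y →
      F (s i) - F y = k ∨ F y - F (s i) = k := by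
    intro i h1 h2 y hy
    rcases hin i h1 h2 y hy with rfl | rfl
    · rw [hFc i h2.le, hFc (i - 1) (by omega)]
      have := hc (i - 1)
      rwa [Nat.sub_add_cancel h1] at this
    · rw [hFc i h2.le, hFc (i + 1) (by omega)]
      exact (hc i).symm
  refine ⟨F, fun x y hxy => ?_⟩
  by_cases hx : x ∈ S
  · by_cases hy : y ∈ S
    · rw [hFS x hx, hFS y hy]
      simp only [f', dif_pos hx, dif_pos hy]
      exact hf ⟨x, hx⟩ ⟨y, hy⟩ hxy
    · obtain ⟨i, h1, h2, rfl⟩ : ∃ i, 0 < i ∧ i < 2 * k ∧ y = s i := by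
        by_contra! hcon
        exact hy hcon
      exact (hstep i h1 h2 x hxy.symm).symm
  · obtain ⟨i, h1, h2, rfl⟩ : ∃ i, 0 < i ∧ i < 2 * k ∧ x = s i := by
      by_contra! hcon
      exact hx hcon
    exact hstep i h1 h2 y hxy

lemma nabla_induce_le (S : Set V) (r : ℕ) : (G.induce S).nabla r ≤ G.nabla r := by
  refine sSup_le_sSup ?_
  rintro x ⟨h, H, hh, ⟨A, hdisj, hconn, hadj⟩, rfl⟩
  refine ⟨h, H, hh, ⟨fun i => Subtype.val '' A i, ?_, ?_, ?_⟩, rfl⟩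
  · intro i j hij
    exact (Set.disjoint_image_iff Subtype.val_injective).mpr (hdisj hij)
  · intro i
    let φ : ((G.induce S).induce (A i)) →g G.induce (Subtype.val '' A i) :=
      ⟨fun x => ⟨x.1.1, x.1, x.2, rfl⟩, fun h => h⟩
    obtain ⟨c, hc⟩ := hconn i
    refine ⟨φ c, ?_⟩
    rintro ⟨_, v, hv, rfl⟩
    obtain ⟨w, hw⟩ := hc ⟨v, hv⟩
    exact ⟨w.map φ, by rwa [Walk.length_map]⟩
  · intro i j hij
    obtain ⟨a, ha, b, hb, hab⟩ := hadj i j hij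
    exact ⟨a, ⟨a, ha, rfl⟩, b, ⟨b, hb, rfl⟩, hab⟩

lemma egirth_le_egirth_induce (S : Set V) : G.egirth ≤ (G.induce S).egirth :=
  IsContained.egirth_le ⟨(Embedding.induce S).toCopy⟩

open scoped Classical in
/-- Graphs of large girth without dense shallow minors map to a long odd cycle. -/
theorem hasOddCycleHom_of_nabla_lt {k n : ℕ} (hk : 0 < k) [Fintype V]
    (hg : ((8 * ((n + 1) * (2 * k)) + 2 : ℕ) : ℕ∞) < G.egirth)
    (hn : G.nabla (2 * ((n + 1) * (2 * k))) < 2 ^ n) : G.HasOddCycleHom k := by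
  induction hm : Fintype.card V using Nat.strong_induction_on generalizing V with
  | _ m ih =>
  subst hm
  have hind : ∀ S : Set V, ∀ v ∉ S, (G.induce S).HasOddCycleHom k := fun S v hv =>
    ih _ (Fintype.card_subtype_lt hv) (hg.trans_le (egirth_le_egirth_induce S))
      ((nabla_induce_le S _).trans_lt hn) rfl
  cases isEmpty_or_nonempty V
  · exact ⟨fun _ => 0, fun u => isEmptyElim u⟩
  by_cases hdeg : ∀ x, 2 ≤ G.degree x
  · by_cases hT : G.NoThread (2 * k)
    · exact absurd hn (two_pow_le_nabla hg hdeg hT).not_gt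
    · simp only [NoThread, not_forall, not_exists, not_and, not_not] at hT
      obtain ⟨s, hinj, hadj, hs⟩ := hT
      rcases Nat.lt_or_ge 1 (2 * k) with h | h
      · exact .of_thread hinj hadj hs (hind _ (s 1) fun h1 => h1 1 one_pos h rfl)
      · omega
  · push Not at hdeg
    obtain ⟨v, hv⟩ := hdeg
    exact .of_degree_le_one (Nat.lt_succ_iff.mp hv) (hind _ v fun h => h rfl)

lemma circChromNum_le_of_hasOddCycleHom {k : ℕ} (hk : 0 < k) (h : G.HasOddCycleHom k) :
    G.circChromNum ≤ 2 + 1 / k := by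
  refine csInf_le ⟨0, ?_⟩ ⟨2 * k + 1, k, by omega, hk, h.isCircularColoring hk, ?_⟩
  · rintro x ⟨n, k, -, -, -, rfl⟩
    positivity
  · push_cast
    field_simp

end Coloring

end SimpleGraph

/-- If the expansion grows subexponentially, then it is eventually beaten by powers of two. -/
lemma GraphClass.exists_expansion_lt_two_pow {C : GraphClass}
    (h : Filter.Tendsto
        (fun r : ℕ => ENNReal.log (C.expansion r) / (r : EReal)) Filter.atTop (nhds 0))
    {p : ℕ} (hp : 0 < p) : ∃ n : ℕ, C.expansion (2 * ((n + 1) * p)) < 2 ^ n := by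
  have hlog : 0 < Real.log 2 := Real.log_pos one_lt_two
  have hδ : (0 : EReal) < ((Real.log 2 / (8 * p) : ℝ) : EReal) :=
    EReal.coe_pos.mpr (by positivity)
  obtain ⟨N, hN⟩ := Filter.eventually_atTop.mp (h.eventually_lt_const hδ)
  refine ⟨N + 1, ?_⟩
  set r := 2 * ((N + 1 + 1) * p) with hr
  have hr0 : 0 < r := by positivity
  have hNr : N ≤ r := by
    have : N + 1 + 1 ≤ (N + 1 + 1) * p := Nat.le_mul_of_pos_right _ hp
    omega
  have h1 := hN r hNr
  rw [EReal.div_lt_iff (by exact_mod_cast hr0) (EReal.natCast_ne_top r)] at h1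
  rw [← ENNReal.log_lt_log_iff, ENNReal.log_pow]
  refine h1.trans ?_
  have h2 : ENNReal.log 2 = ((Real.log 2 : ℝ) : EReal) := by
    rw [ENNReal.log_pos_real (by simp) (by simp)]
    simp
  rw [h2]
  have h3 : Real.log 2 / (8 * p) * (r : ℝ) < ((N + 1 : ℕ) : ℝ) * Real.log 2 := by
    have hp' : (0 : ℝ) < p := by exact_mod_cast hp
    rw [hr, div_mul_eq_mul_div, div_lt_iff₀ (by positivity)]
    push_cast
    have : 0 < Real.log 2 * p := by positivity
    nlinarith [mul_nonneg this.le (Nat.cast_nonneg (α := ℝ) N)]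
  exact_mod_cast h3

theorem circular_chromatic_of_large_girth_subexponential_expansion
    (C : GraphClass)
    (h : Filter.Tendsto
        (fun r : ℕ => ENNReal.log (C.expansion r) / (r : EReal)) Filter.atTop (nhds 0)) :
    ∀ ε : ℝ, 0 < ε → ∃ g : ℕ, ∀ G ∈ C, (g : ℕ∞) ≤ (Sigma.snd G).egirth →
      (Sigma.snd G).circChromNum ≤ 2 + ε := by
  intro ε hε
  obtain ⟨k, hk⟩ := exists_nat_one_div_lt hε
  obtain ⟨n, hn⟩ := GraphClass.exists_expansion_lt_two_pow h (p := 2 * (k + 1)) (by omega)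
  refine ⟨8 * ((n + 1) * (2 * (k + 1))) + 3, fun G hG hgirth => ?_⟩
  have hhom : G.2.HasOddCycleHom (k + 1) := by
    refine hasOddCycleHom_of_nabla_lt (n := n) k.succ_pos
      (lt_of_lt_of_le (Nat.cast_lt.mpr (by omega)) hgirth) (lt_of_le_of_lt ?_ hn)
    exact le_sSup ⟨G, hG, rfl⟩
  refine (circChromNum_le_of_hasOddCycleHom k.succ_pos hhom).trans ?_
  push_cast
  linarith
end

section
/- Let C be a class of (finite simple) graphs and let n, d be positive integers with d ≥ 2 and n > d. If log(Ex_C(r))/r ≤ (d−1)/(5(n−1)) holds for every positive integer r (natural logarithm), then there is an integer g such that for every orientation G⃗ of a graph G ∈ C with girth at least g there exists a digraph homomorphism from G⃗ to the circulant digraph C⃗_n^d. -/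
open SimpleGraph ENNReal

universe u

namespace SimpleGraph

variable {V : Type u} {G : SimpleGraph V}

lemma egirth_le_of_adj_of_walk {a b : V} (hab : G.Adj a b) (w : G.Walk b a)
    (hw : s(a, b) ∉ w.edges) : G.egirth ≤ (w.length + 1 : ℕ) := by
  classical
  have hc : (Walk.cons hab w.bypass).IsCycle :=
    (Walk.cons_isCycle_iff _ _).2 ⟨w.bypass_isPath, fun he ↦ hw (w.edges_bypass_subset_edges he)⟩
  refine (egirth_le_length hc).trans ?_
  have := w.length_bypass_le_length
  rw [Walk.length_cons]
  exact_mod_cast Nat.succ_le_succ this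

/-- A set `T` within distance `L` of every vertex is the set of roots of a spanning forest, given
by a parent map `π` and a root map `ρ`, in which every vertex has depth at most `L`. -/
lemma exists_rooted_forest {T : Set V} {L : ℕ}
    (hT : ∀ v, ∃ t ∈ T, ∃ w : G.Walk v t, w.length ≤ L) :
    ∃ π ρ : V → V, (∀ v, ρ v ∈ T) ∧ (∀ v ∈ T, ρ v = v) ∧
      ∀ v, ∃ w : G.Walk v (ρ v), w.length ≤ L ∧ (∀ e ∈ w.edges, ∃ u ∉ T, e = s(u, π u)) ∧
        ∀ u ∈ w.support, ρ u = ρ v := by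
  classical
  have hex : ∀ v, ∃ k, ∃ t ∈ T, ∃ w : G.Walk v t, w.length = k := fun v ↦ by
    obtain ⟨t, ht, w, -⟩ := hT v
    exact ⟨_, t, ht, w, rfl⟩
  let D : V → ℕ := fun v ↦ Nat.find (hex v)
  have hD : ∀ v t, t ∈ T → ∀ w : G.Walk v t, D v ≤ w.length := fun v t ht w ↦
    Nat.find_min' (hex v) ⟨t, ht, w, rfl⟩
  have hstep : ∀ v, ∃ u, v ∉ T → G.Adj v u ∧ D u + 1 = D v := by
    intro v
    by_cases hv : v ∈ T
    · exact ⟨v, fun h ↦ absurd hv h⟩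
    obtain ⟨t, ht, w, hw⟩ := Nat.find_spec (hex v)
    cases w with
    | nil => exact absurd ht hv
    | @cons _ u _ hadj w =>
      refine ⟨u, fun _ ↦ ⟨hadj, ?_⟩⟩
      have h1 := hD u t ht w
      obtain ⟨t', ht', w', hw'⟩ := Nat.find_spec (hex u)
      have h2 := hD v t' ht' (Walk.cons hadj w')
      rw [Walk.length_cons] at h2 hw
      change _ = D v at hw
      change _ = D u at hw'
      omega
  choose π hπ using hstep
  have hD0 : ∀ v, D v = 0 ↔ v ∈ T := by
    intro v
    refine ⟨fun h ↦ by_contra fun hv ↦ ?_, fun hv ↦ Nat.le_zero.1 (hD v v hv Walk.nil)⟩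
    have := (hπ v hv).2
    omega
  let ρ : V → V := fun v ↦ π^[D v] v
  have hρT : ∀ v ∈ T, ρ v = v := fun v hv ↦ by simp [ρ, (hD0 v).2 hv]
  have hρπ : ∀ v ∉ T, ρ (π v) = ρ v := fun v hv ↦ by
    simp only [ρ, ← (hπ v hv).2, Function.iterate_succ_apply]
  have key : ∀ k v, D v = k → ρ v ∈ T ∧ ∃ w : G.Walk v (ρ v), w.length ≤ D v ∧
      (∀ e ∈ w.edges, ∃ u ∉ T, e = s(u, π u)) ∧ ∀ u ∈ w.support, ρ u = ρ v := by
    intro k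
    induction k with
    | zero =>
      intro v hv
      have hvT := (hD0 v).1 hv
      have hr := hρT v hvT
      refine ⟨hr.symm ▸ hvT, Walk.nil.copy rfl hr.symm, by simp, by simp, by simp⟩
    | succ k ih =>
      intro v hv
      have hvT : v ∉ T := fun h ↦ by have := (hD0 v).2 h; omega
      obtain ⟨hadj, hDπ⟩ := hπ v hvT
      obtain ⟨h1, w, h2, h3, h4⟩ := ih (π v) (by omega)
      have hr := hρπ v hvT
      refine ⟨hr ▸ h1, (Walk.cons hadj w).copy rfl hr, ?_, ?_, ?_⟩
      · simp only [Walk.length_copy, Walk.length_cons]; omega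
      · simp only [Walk.edges_copy, Walk.edges_cons, List.mem_cons]
        rintro e (rfl | he)
        · exact ⟨v, hvT, rfl⟩
        · exact h3 e he
      · simp only [Walk.support_copy, Walk.support_cons, List.mem_cons]
        rintro u (rfl | hu)
        · rfl
        · exact (h4 u hu).trans hr
  refine ⟨π, ρ, fun v ↦ (key _ v rfl).1, hρT, fun v ↦ ?_⟩
  obtain ⟨-, w, h2, h3, h4⟩ := key _ v rfl
  obtain ⟨t, ht, w', hw'⟩ := hT v
  exact ⟨w, h2.trans ((hD v t ht w').trans hw'), h3, h4⟩

lemma exists_dense_isShallowMinor [Fintype V] [Nonempty V] [DecidableRel G.Adj] {L : ℕ}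
    (hg : ((4 * L + 3 : ℕ) : ℕ∞) ≤ G.egirth) (hdeg : ∀ v, 2 ≤ G.degree v)
    (hbranch : ∀ v, ∃ t, 3 ≤ G.degree t ∧ ∃ w : G.Walk v t, w.length ≤ L) :
    ∃ (h : ℕ) (H : SimpleGraph (Fin h)), 0 < h ∧ G.IsShallowMinor L H ∧
      3 * h ≤ 2 * Nat.card H.edgeSet := by
  classical
  let T : Finset V := {v | 3 ≤ G.degree v}
  obtain ⟨π, ρ, hρ, hρT, hw⟩ := exists_rooted_forest (G := G) (T := (T : Set V)) (L := L)
    (fun v ↦ by simpa [T] using hbranch v)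
  choose w hwL hwE hwS using hw
  let e : T ≃ Fin T.card := T.equivFin
  let φ : V → Fin T.card := fun v ↦ e ⟨ρ v, hρ v⟩
  have hφ : ∀ {u v}, φ u = φ v → ρ u = ρ v := fun h ↦ by simpa [φ] using h
  let H : SimpleGraph (Fin T.card) :=
    { Adj := fun i j ↦ i ≠ j ∧ ∃ a b, φ a = i ∧ φ b = j ∧ G.Adj a b
      symm := ⟨fun i j ⟨h, a, b, ha, hb, hab⟩ ↦ ⟨h.symm, b, a, hb, ha, hab.symm⟩⟩
      loopless := ⟨fun i h ↦ h.1 rfl⟩ }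
  have hcard : 0 < T.card := by
    obtain ⟨v⟩ := ‹Nonempty V›
    exact Finset.card_pos.2 ⟨ρ v, hρ v⟩
  refine ⟨T.card, H, hcard, ⟨fun i ↦ {v | φ v = i}, ?_, ?_, ?_⟩, ?_⟩
  · intro i j hij
    rw [Set.disjoint_left]
    rintro v rfl hv
    exact hij hv
  · intro i
    obtain ⟨⟨t, ht⟩, rfl⟩ := e.surjective i
    refine ⟨⟨t, ?_⟩, ?_⟩
    · simp [φ, hρT t ht]
    rintro ⟨v, hv⟩
    have hv' : ρ v = t := by simpa [φ] using hv
    refine ⟨(((w v).copy rfl hv').induce {v | φ v = e ⟨t, ht⟩} ?_).reverse, ?_⟩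
    · intro u hu
      rw [Walk.support_copy] at hu
      simp [φ, hwS v u hu, hv']
    · rw [Walk.length_reverse, ← Walk.length_map (Embedding.induce _).toHom, Walk.map_induce]
      exact (Walk.length_copy _ _ _).trans_le (hwL v)
  · rintro i j ⟨-, a, b, ha, hb, hab⟩
    exact ⟨a, ha, b, hb, hab⟩
  · let F : Finset (Sym2 V) := Tᶜ.image fun v ↦ s(v, π v)
    have hF : ∀ u v, s(u, v) ∉ F → ∀ x, s(u, v) ∉ (w x).edges := by
      intro u v huv x hx
      obtain ⟨y, hy, h⟩ := hwE x _ hx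
      exact huv (Finset.mem_image.2 ⟨y, by simpa using hy, h.symm⟩)
    have hFcard : F.card ≤ Fintype.card V - T.card := by
      rw [← Finset.card_compl]
      exact Finset.card_image_le
    have hsmall : ∀ {m : ℕ}, m ≤ 4 * L + 2 → ¬ G.egirth ≤ (m : ℕ∞) := fun hm h ↦ by
      have := hg.trans h
      rw [Nat.cast_le] at this
      omega
    have hne : ∀ {a b}, G.Adj a b → s(a, b) ∉ F → φ a ≠ φ b := by
      intro a b hab habF heq
      refine hsmall ?_ (egirth_le_of_adj_of_walk hab
        ((w b).append ((w a).reverse.copy (hφ heq) rfl)) ?_)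
      · have := hwL a; have := hwL b
        simp only [Walk.length_append, Walk.length_copy, Walk.length_reverse]; omega
      · simp [hF a b habF]
    have hpar : ∀ {a b c d}, G.Adj a b → s(a, b) ∉ F → G.Adj c d → s(a, b) ≠ s(c, d) →
        φ a = φ c → φ b = φ d → False := by
      intro a b c d hab habF hcd hneq hac hbd
      refine hsmall ?_ (egirth_le_of_adj_of_walk hab
        ((w b).append (((w d).reverse.copy (hφ hbd).symm rfl).append (Walk.cons hcd.symm
          ((w c).append ((w a).reverse.copy (hφ hac) rfl))))) ?_)
      · have := hwL a; have := hwL b; have := hwL c; have := hwL d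
        simp only [Walk.length_append, Walk.length_copy, Walk.length_reverse, Walk.length_cons]
        omega
      · rw [Sym2.eq_swap (a := c)] at hneq
        simp [hF a b habF, -Sym2.eq, hneq]
    have hle : (G.edgeFinset \ F).card ≤ H.edgeFinset.card := by
      refine Finset.card_le_card_of_injOn (Sym2.map φ) ?_ ?_
      · intro z
        induction z with | _ a b
        intro hz
        simp only [Finset.coe_sdiff, Set.mem_sdiff, Finset.mem_coe, mem_edgeFinset,
          mem_edgeSet] at hz
        simp only [Sym2.map_mk, Finset.mem_coe, mem_edgeFinset, mem_edgeSet]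
        exact ⟨hne hz.1 hz.2, a, b, rfl, rfl, hz.1⟩
      · intro z hz z' hz' h
        induction z with | _ a b
        induction z' with | _ c d
        simp only [Finset.coe_sdiff, Set.mem_sdiff, Finset.mem_coe, mem_edgeFinset,
          mem_edgeSet] at hz hz'
        by_contra hzz
        rw [Sym2.map_mk, Sym2.map_mk, Sym2.eq_iff] at h
        rcases h with ⟨h1, h2⟩ | ⟨h1, h2⟩
        · exact hpar hz.1 hz.2 hz'.1 hzz h1 h2
        · exact hpar hz.1 hz.2 hz'.1.symm (by rwa [Sym2.eq_swap (a := d)]) h1 h2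
    have hsum : 2 * Fintype.card V + T.card ≤ 2 * G.edgeFinset.card := by
      rw [← sum_degrees_eq_twice_card_edges, Finset.card_filter, Fintype.card,
        Finset.card_eq_sum_ones, Finset.mul_sum, ← Finset.sum_add_distrib]
      refine Finset.sum_le_sum fun v _ ↦ ?_
      have := hdeg v
      split_ifs <;> omega
    have hTV : T.card ≤ Fintype.card V := Finset.card_le_univ T
    have := Finset.le_card_sdiff F G.edgeFinset
    rw [Nat.card_eq_fintype_card, ← edgeFinset_card]
    omega

lemma IsShallowMinor.of_induce {S : Set V} {r h : ℕ} {H : SimpleGraph (Fin h)}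
    (hH : (G.induce S).IsShallowMinor r H) : G.IsShallowMinor r H := by
  obtain ⟨A, hdisj, hrad, hadj⟩ := hH
  refine ⟨fun i ↦ Subtype.val '' A i, fun i j hij ↦ ?_, fun i ↦ ?_, fun i j hij ↦ ?_⟩
  · exact Set.disjoint_image_of_injective Subtype.val_injective (hdisj hij)
  · obtain ⟨c, hc⟩ := hrad i
    let φ : (G.induce S).induce (A i) →g G.induce (Subtype.val '' A i) :=
      { toFun := fun v ↦ ⟨v.1.1, v.1, v.2, rfl⟩
        map_rel' := fun h ↦ h }
    refine ⟨φ c, ?_⟩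
    rintro ⟨_, v, hv, rfl⟩
    obtain ⟨w, hw⟩ := hc ⟨v, hv⟩
    exact ⟨w.map φ, by rwa [Walk.length_map]⟩
  · obtain ⟨a, ha, b, hb, hab⟩ := hadj i j hij
    exact ⟨a, ⟨a, ha, rfl⟩, b, ⟨b, hb, rfl⟩, hab⟩

/-- Non-backtracking walks shorter than the girth do not revisit vertices. -/
lemma injOn_of_lt_egirth {s : ℕ → V} {m : ℕ} (hm : (m : ℕ∞) < G.egirth)
    (hadj : ∀ i < m, G.Adj (s i) (s (i + 1))) (hback : ∀ i, i + 1 < m → s (i + 2) ≠ s i) :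
    Set.InjOn s (Set.Iic m) := by
  have hwalk : ∀ a k, a + k ≤ m → ∃ w : G.Walk (s a) (s (a + k)), w.length = k ∧
      ∀ e ∈ w.edges, ∃ l, a ≤ l ∧ l < a + k ∧ e = s(s l, s (l + 1)) := by
    intro a k
    induction k with
    | zero => exact fun _ ↦ ⟨Walk.nil, by simp⟩
    | succ k ih =>
      intro hk
      obtain ⟨w, hw, he⟩ := ih (by omega)
      refine ⟨w.concat (hadj (a + k) (by omega)), by simp [hw], ?_⟩
      intro e hemem
      rw [Walk.edges_concat, List.concat_eq_append, List.mem_append, List.mem_singleton] at hemem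
      rcases hemem with h | h
      · obtain ⟨l, h1, h2, h3⟩ := he e h
        exact ⟨l, h1, by omega, h3⟩
      · exact ⟨a + k, by omega, by omega, h⟩
  have key : ∀ k i, 0 < k → i + k ≤ m → s i ≠ s (i + k) := by
    intro k
    induction k using Nat.strong_induction_on with | _ k ih
    intro i hk hik heq
    obtain rfl | hk1 := eq_or_ne k 1
    · exact (hadj i (by omega)).ne heq
    obtain rfl | hk2 := eq_or_ne k 2
    · exact hback i (by omega) heq.symm
    obtain ⟨w, hw, he⟩ := hwalk (i + 1) (k - 1) (by omega)
    have hend : s (i + 1 + (k - 1)) = s i := by rw [heq]; congr 1; omega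
    have hle := egirth_le_of_adj_of_walk (hadj i (by omega)) (w.copy rfl hend) (by
      rw [Walk.edges_copy]
      intro hmem
      obtain ⟨l, h1, h2, h3⟩ := he _ hmem
      have hlt : ∀ l, i < l → l < i + k → s i ≠ s l := fun l h1 h2 ↦ by
        have := ih (l - i) (by omega) i (by omega) (by omega)
        rwa [Nat.add_sub_cancel' h1.le] at this
      rcases Sym2.eq_iff.1 h3 with ⟨h4, -⟩ | ⟨h4, h5⟩
      · exact hlt l (by omega) (by omega) h4
      · by_cases hl : l + 1 < i + k
        · exact hlt (l + 1) (by omega) hl h4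
        · refine ih (k - 2) (by omega) (i + 1) (by omega) (by omega) ?_
          rw [h5]; congr 1; omega)
    rw [Walk.length_copy, hw] at hle
    have := hm.trans_le hle
    rw [Nat.cast_lt] at this
    omega
  intro i hi j hj hij
  rw [Set.mem_Iic] at hi hj
  by_contra hne
  rcases Nat.lt_or_gt_of_ne hne with h | h
  · exact key (j - i) i (by omega) (by omega) (by rwa [Nat.add_sub_cancel' h.le])
  · exact key (i - j) j (by omega) (by omega) (by rw [Nat.add_sub_cancel' h.le, hij])

end SimpleGraph

/-- In `C⃗_n^d`, two arbitrary vertices are joined by a walk along any prescribed pattern of forward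
(`p i`) and backward (`¬ p i`) arcs, provided the pattern has length at least
`(n - 1) / (d - 1)`. -/
lemma circulantDigraph_exists_walk {n d m : ℕ} (hd : 1 ≤ d) (hn : 0 < n)
    (hm : n ≤ m * (d - 1) + 1) (p : ℕ → Prop) (α β : ZMod n) :
    ∃ c : ℕ → ZMod n, c 0 = α ∧ c m = β ∧
      ∀ i, (p i → circulantDigraph n d (c i) (c (i + 1))) ∧
        (¬ p i → circulantDigraph n d (c (i + 1)) (c i)) := by
  classical
  have : NeZero n := ⟨hn.ne'⟩
  let b : ℕ → ZMod n := fun i ↦ α + ∑ j ∈ Finset.range i, if p j then 1 else -(d : ZMod n)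
  let t : ℕ := (β - b m).val
  have ht : t < n := ZMod.val_lt _
  refine ⟨fun i ↦ b i + (min t (i * (d - 1)) : ℕ), by simp [b], ?_, fun i ↦ ?_⟩
  · have : min t (m * (d - 1)) = t := by omega
    simp only [this, t, ZMod.natCast_zmod_val, add_sub_cancel]
  · obtain ⟨x, hx, hxd⟩ : ∃ x, min t ((i + 1) * (d - 1)) = min t (i * (d - 1)) + x ∧
        x ≤ d - 1 := by
      rw [Nat.succ_mul]
      exact ⟨min t (i * (d - 1) + (d - 1)) - min t (i * (d - 1)), by omega, by omega⟩
    refine ⟨fun h ↦ ⟨1 + x, by omega, by omega, ?_⟩, fun h ↦ ⟨d - x, by omega, by omega, ?_⟩⟩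
    · simp only [b, hx, Finset.sum_range_succ, if_pos h]
      push_cast
      ring
    · have hxd' : x ≤ d := by omega
      simp only [b, hx, Finset.sum_range_succ, if_neg h]
      push_cast [hxd']
      ring

namespace SimpleGraph

lemma exists_hom_circulantDigraph {n d L : ℕ} (hd : 1 ≤ d) (hn : 0 < n) (hL : 0 < L)
    (hLn : n ≤ (L + 1) * (d - 1) + 1) {V : Type u} [Finite V] {G : SimpleGraph V}
    (hg : ((4 * L + 3 : ℕ) : ℕ∞) ≤ G.egirth)
    (hsparse : ∀ (h : ℕ) (H : SimpleGraph (Fin h)), 0 < h → G.IsShallowMinor L H →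
      2 * Nat.card H.edgeSet < 3 * h)
    {o : V → V → Prop} (ho : G.IsOrientation o) :
    ∃ f : V → ZMod n, ∀ u v, o u v → circulantDigraph n d (f u) (f v) := by
  classical
  induction hN : Nat.card V using Nat.strong_induction_on generalizing V with | _ N ih
  have := Fintype.ofFinite V
  have hdel : ∀ P : Set V, P.Nonempty → ∃ f : V → ZMod n, ∀ u v, u ∉ P → v ∉ P → o u v →
      circulantDigraph n d (f u) (f v) := by
    rintro P ⟨x, hx⟩
    obtain ⟨f, hf⟩ := ih (Nat.card (Pᶜ : Set V))
      (hN ▸ Finite.card_subtype_lt (x := x) (by simpa using hx))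
      (V := (Pᶜ : Set V)) (G := G.induce Pᶜ) (o := fun u v ↦ o u v)
      (hg.trans (IsContained.egirth_le ⟨(Embedding.induce _).toCopy⟩))
      (fun h H hh hH ↦ hsparse h H hh hH.of_induce)
      ⟨fun u v h ↦ ho.1 _ _ h, fun u v h ↦ ho.2 _ _ h⟩ rfl
    refine ⟨fun v ↦ if h : v ∈ Pᶜ then f ⟨v, h⟩ else 0, fun u v hu hv huv ↦ ?_⟩
    have hu' : u ∈ Pᶜ := hu
    have hv' : v ∈ Pᶜ := hv
    simp only [dif_pos hu', dif_pos hv']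
    exact hf _ _ huv
  by_cases hdeg : ∃ v, G.degree v < 2
  · obtain ⟨v, hv⟩ := hdeg
    obtain ⟨f, hf⟩ := hdel {v} ⟨v, rfl⟩
    obtain ⟨u, hu⟩ : ∃ u, ∀ x, G.Adj v x → x = u := by
      have : Nonempty V := ⟨v⟩
      obtain ⟨u, hu⟩ := Finset.card_le_one_iff_subset_singleton.1 (Nat.le_of_lt_succ hv)
      exact ⟨u, fun x hx ↦ by simpa using hu ((G.mem_neighborFinset v x).2 hx)⟩
    refine ⟨Function.update f v (if o v u then f u - 1 else f u + 1), fun x y hxy ↦ ?_⟩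
    have hadj := ho.1 x y hxy
    by_cases hx : x = v
    · subst hx
      obtain rfl := hu y hadj
      rw [Function.update_self, Function.update_of_ne hadj.ne', if_pos hxy]
      exact ⟨1, le_rfl, hd, by simp⟩
    by_cases hy : y = v
    · subst hy
      obtain rfl := hu x hadj.symm
      rw [Function.update_self, Function.update_of_ne hadj.ne,
        if_neg ((ho.2 _ _ hadj).1 hxy)]
      exact ⟨1, le_rfl, hd, by simp⟩
    rw [Function.update_of_ne hx, Function.update_of_ne hy]
    exact hf x y hx hy hxy
  push Not at hdeg
  by_cases hbranch : ∀ v, ∃ t, 3 ≤ G.degree t ∧ ∃ w : G.Walk v t, w.length ≤ L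
  · rcases isEmpty_or_nonempty V with hV | hV
    · exact ⟨fun _ ↦ 0, fun u ↦ isEmptyElim u⟩
    obtain ⟨h, H, hh, hH, hle⟩ := exists_dense_isShallowMinor hg hdeg hbranch
    exact absurd hle (hsparse h H hh hH).not_ge
  push Not at hbranch
  obtain ⟨v, hv⟩ := hbranch
  have hnext : ∀ a b, ∃ c, G.Adj a b → G.degree b = 2 →
      G.Adj b c ∧ c ≠ a ∧ ∀ x, G.Adj b x → x = a ∨ x = c := by
    intro a b
    by_cases hab : G.Adj a b ∧ G.degree b = 2
    · obtain ⟨x, y, hxy, hN⟩ := Finset.card_eq_two.1 hab.2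
      have hmem : ∀ z, G.Adj b z ↔ z = x ∨ z = y := fun z ↦ by
        rw [← mem_neighborFinset, hN]; simp
      rcases (hmem a).1 hab.1.symm with rfl | rfl
      · exact ⟨y, fun _ _ ↦ ⟨(hmem y).2 (Or.inr rfl), hxy.symm, fun z hz ↦ (hmem z).1 hz⟩⟩
      · exact ⟨x, fun _ _ ↦ ⟨(hmem x).2 (Or.inl rfl), hxy, fun z hz ↦ ((hmem z).1 hz).symm⟩⟩
    · exact ⟨a, fun h1 h2 ↦ absurd ⟨h1, h2⟩ hab⟩
  choose next hnext using hnext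
  obtain ⟨a, ha⟩ : ∃ a, G.Adj v a := by
    rw [← degree_pos_iff_exists_adj]
    exact lt_of_lt_of_le two_pos (hdeg v)
  let q : ℕ → V × V := fun i ↦ (fun x : V × V ↦ (x.2, next x.1 x.2))^[i] (a, v)
  let s : ℕ → V := fun i ↦ (q i).1
  have hq : ∀ i, q (i + 1) = ((q i).2, next (q i).1 (q i).2) := fun i ↦
    Function.iterate_succ_apply' _ _ _
  have hs2 : ∀ i, s (i + 2) = next (s i) (s (i + 1)) := fun i ↦ by simp only [s, hq]
  have hpath : ∀ i ≤ L, G.Adj (s i) (s (i + 1)) ∧ ∃ w : G.Walk v (s (i + 1)), w.length ≤ i := by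
    intro i
    induction i with
    | zero => exact fun _ ↦ ⟨ha.symm, Walk.nil, le_rfl⟩
    | succ i ihi =>
      intro hi
      obtain ⟨h1, w, hw⟩ := ihi (by omega)
      have hdeg2 : G.degree (s (i + 1)) = 2 := by
        refine le_antisymm (not_lt.1 fun h ↦ ?_) (hdeg _)
        exact absurd (hv _ h w) (by omega)
      have hadj := (hnext _ _ h1 hdeg2).1
      rw [← hs2] at hadj
      exact ⟨hadj, w.concat hadj, by rw [Walk.length_concat]; omega⟩
  have hnbr : ∀ i ≤ L, s (i + 2) ≠ s i ∧
      ∀ x, G.Adj (s (i + 1)) x → x = s i ∨ x = s (i + 2) := by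
    intro i hi
    obtain ⟨h1, w, hw⟩ := hpath i hi
    rw [hs2]
    refine (hnext _ _ h1 (le_antisymm (not_lt.1 fun h ↦ ?_) (hdeg _))).2
    exact absurd (hv _ h w) (by omega)
  have hinj : Set.InjOn s (Set.Iic (L + 1)) := by
    refine injOn_of_lt_egirth (lt_of_lt_of_le ?_ hg) (fun i hi ↦ (hpath i (by omega)).1)
      fun i hi ↦ (hnbr i (by omega)).1
    rw [Nat.cast_lt]
    omega
  let P : Set V := {x | ∃ i < L, s (i + 1) = x}
  obtain ⟨f, hf⟩ := hdel P ⟨_, 0, hL, rfl⟩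
  obtain ⟨c, hc0, hcL, hc⟩ := circulantDigraph_exists_walk hd hn hLn
    (fun i ↦ o (s i) (s (i + 1))) (f (s 0)) (f (s (L + 1)))
  let f' : V → ZMod n := fun x ↦ if h : ∃ i, i ≤ L + 1 ∧ s i = x then c h.choose else f x
  have hf's : ∀ i ≤ L + 1, f' (s i) = c i := by
    intro i hi
    have h : ∃ j, j ≤ L + 1 ∧ s j = s i := ⟨i, hi, rfl⟩
    simp only [f', dif_pos h]
    rw [hinj h.choose_spec.1 hi h.choose_spec.2]
  have hf'P : ∀ x ∉ P, f' x = f x := by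
    intro x hx
    by_cases h : ∃ i, i ≤ L + 1 ∧ s i = x
    · obtain ⟨i, hi, rfl⟩ := h
      rw [hf's i hi]
      obtain rfl | rfl : i = 0 ∨ i = L + 1 := by
        by_contra hne
        exact hx ⟨i - 1, by omega, by congr 1; omega⟩
      · exact hc0
      · exact hcL
    · simp only [f', dif_neg h]
  have hedge : ∀ x y, G.Adj x y → x ∈ P →
      ∃ i ≤ L, (x = s i ∧ y = s (i + 1)) ∨ (x = s (i + 1) ∧ y = s i) := by
    rintro x y hxy ⟨i, hi, rfl⟩
    rcases (hnbr i hi.le).2 y hxy with rfl | rfl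
    · exact ⟨i, hi.le, Or.inr ⟨rfl, rfl⟩⟩
    · exact ⟨i + 1, hi, Or.inl ⟨rfl, rfl⟩⟩
  refine ⟨f', fun x y hxy ↦ ?_⟩
  have hadj := ho.1 x y hxy
  by_cases hP : x ∈ P ∨ y ∈ P
  · obtain ⟨i, hi, h⟩ : ∃ i ≤ L, (x = s i ∧ y = s (i + 1)) ∨ (x = s (i + 1) ∧ y = s i) := by
      rcases hP with hx | hy
      · exact hedge x y hadj hx
      · obtain ⟨i, hi, h⟩ := hedge y x hadj.symm hy
        exact ⟨i, hi, h.symm.imp And.symm And.symm⟩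
    rcases h with ⟨rfl, rfl⟩ | ⟨rfl, rfl⟩
    · rw [hf's i (by omega), hf's (i + 1) (by omega)]
      exact (hc i).1 hxy
    · rw [hf's i (by omega), hf's (i + 1) (by omega)]
      exact (hc i).2 ((ho.2 _ _ hadj).1 hxy)
  · push Not at hP
    rw [hf'P x hP.1, hf'P y hP.2]
    exact hf x y hP.1 hP.2 hxy

end SimpleGraph

theorem oriented_hom_to_circulant_of_large_girth
    (C : GraphClass) (n d : ℕ) (hd : 2 ≤ d) (hn : d < n)
    (h : ∀ r : ℕ, 0 < r →
      ENNReal.log (C.expansion r) / (r : EReal)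
        ≤ ((((d : ℝ) - 1) / (5 * ((n : ℝ) - 1)) : ℝ) : EReal)) :
    ∃ g : ℕ, ∀ G ∈ C, (g : ℕ∞) ≤ (Sigma.snd G).egirth →
      ∀ o : Fin G.1 → Fin G.1 → Prop, (Sigma.snd G).IsOrientation o →
        ∃ f : Fin G.1 → ZMod n, ∀ u v, o u v → circulantDigraph n d (f u) (f v) := by
  obtain ⟨L, hL, hLn, hnL⟩ : ∃ L : ℕ, 0 < L ∧ n ≤ (L + 1) * (d - 1) + 1 ∧
      L * (d - 1) < n - 1 := by
    refine ⟨(n - 2) / (d - 1), Nat.div_pos (by omega) (by omega), ?_, ?_⟩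
    · have := Nat.lt_mul_div_succ (n - 2) (show 0 < d - 1 by omega)
      rw [mul_comm] at this
      omega
    · have := Nat.div_mul_le_self (n - 2) (d - 1)
      omega
  have hexp : C.expansion L < ENNReal.ofReal (3 / 2) := by
    have hLpos : (0 : ℝ) < L := by exact_mod_cast hL
    have hlog := h L hL
    rw [EReal.div_le_iff_le_mul (by exact_mod_cast hL) (EReal.natCast_ne_top L)] at hlog
    rw [← ENNReal.log_lt_log_iff, ENNReal.log_ofReal_of_pos (by norm_num)]
    refine hlog.trans_lt ?_
    have hcast : ((L : EReal)) = ((L : ℝ) : EReal) := rfl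
    rw [hcast, ← EReal.coe_mul, EReal.coe_lt_coe_iff]
    have h1 : (L : ℝ) * (d - 1) < n - 1 := by
      have h2 : ((L * (d - 1) : ℕ) : ℝ) < ((n - 1 : ℕ) : ℝ) := by exact_mod_cast hnL
      rwa [Nat.cast_mul, Nat.cast_sub (by omega), Nat.cast_sub (by omega), Nat.cast_one] at h2
    have hn1 : (0 : ℝ) < n - 1 := by
      have : (1 : ℝ) < n := by exact_mod_cast (by omega : 1 < n)
      linarith
    have h3 : (L : ℝ) * (((d : ℝ) - 1) / (5 * ((n : ℝ) - 1))) < 1 / 5 := by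
      rw [← mul_div_assoc, div_lt_div_iff₀ (by positivity) (by norm_num)]
      linarith
    have h4 := Real.one_sub_inv_le_log_of_pos (show (0 : ℝ) < 3 / 2 by norm_num)
    norm_num at h4 h3 ⊢
    linarith
  refine ⟨4 * L + 3, fun G hG hg o ho ↦ ?_⟩
  refine exists_hom_circulantDigraph (by omega) (by omega) hL hLn hg (fun k H hk hH ↦ ?_) ho
  have hle : (Nat.card H.edgeSet : ℝ≥0∞) / (k : ℝ≥0∞) ≤ C.expansion L := calc
    _ ≤ G.2.nabla L := le_sSup ⟨k, H, hk, hH, rfl⟩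
    _ ≤ C.expansion L := le_sSup ⟨G, hG, rfl⟩
  have hlt := hle.trans_lt hexp
  have hk' : (0 : ℝ) < k := by exact_mod_cast hk
  rw [← ENNReal.ofReal_natCast, ← ENNReal.ofReal_natCast, ← ENNReal.ofReal_div_of_pos hk',
    ENNReal.ofReal_lt_ofReal_iff (by norm_num), div_lt_div_iff₀ hk' two_pos] at hlt
  have : Nat.card H.edgeSet * 2 < 3 * k := by exact_mod_cast hlt
  omega
end

section
/- Let C be a class of (finite simple) graphs such that limsup_{r→∞} log(Ex_C(r))/r ≤ 1/20 (natural logarithm). Then there is an integer g such that every graph G ∈ C with girth at least g has oriented chromatic number at most 5; moreover every orientation of such a G admits a homomorphism to the tournament C⃗_5^2 (vertex set ℤ_5, arcs (i,j) for j − i ∈ {1,2} mod 5). -/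
open SimpleGraph ENNReal

universe u

section VoronoiForest

variable {W : Type u} {K : SimpleGraph W}

/-- A shortest-path forest of `K` rooted at the elements of `X`: every vertex outside `X` has a
parent which is one step closer to `X`. The trees, i.e. the fibres of `root`, have height at most
`n`, and the roots are pairwise at distance more than `n`. -/
structure VoronoiForest (K : SimpleGraph W) (n : ℕ) where
  X : Finset W
  par : W → W
  root : W → W
  depth : W → ℕ
  root_of_mem : ∀ x ∈ X, root x = x
  depth_of_mem : ∀ x ∈ X, depth x = 0
  adj_par : ∀ v ∉ X, K.Adj v (par v)
  depth_par : ∀ v ∉ X, depth v = depth (par v) + 1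
  root_par : ∀ v ∉ X, root v = root (par v)
  depth_le : ∀ v, depth v ≤ n
  depth_adj : ∀ u v, K.Adj u v → depth v ≤ depth u + 1
  separated : ∀ x ∈ X, ∀ y ∈ X, x ≠ y → ∀ p : K.Walk x y, n < p.length

/-- In a finite graph there is a maximal set of vertices which are pairwise at distance more
than `n`; every vertex is within distance `n` of it. -/
theorem exists_separated_net [Fintype W] (K : SimpleGraph W) (n : ℕ) :
    ∃ X : Finset W, (∀ x ∈ X, ∀ y ∈ X, x ≠ y → ∀ p : K.Walk x y, n < p.length) ∧
      ∀ v, ∃ x ∈ X, ∃ p : K.Walk v x, p.length ≤ n := by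
  classical
  obtain ⟨X, hX⟩ := Finset.exists_maximal
    (s := Finset.univ.filter fun X : Finset W =>
      ∀ x ∈ X, ∀ y ∈ X, x ≠ y → ∀ p : K.Walk x y, n < p.length) ⟨∅, by simp⟩
  have hsep := (Finset.mem_filter.1 hX.1).2
  refine ⟨X, hsep, fun v => ?_⟩
  by_contra! hv
  have hvX : v ∉ X := fun hvX => by simpa using hv v hvX Walk.nil
  have hins : insert v X ∈ Finset.univ.filter fun X : Finset W =>
      ∀ x ∈ X, ∀ y ∈ X, x ≠ y → ∀ p : K.Walk x y, n < p.length := by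
    refine Finset.mem_filter.2 ⟨Finset.mem_univ _, fun x hx y hy hxy p => ?_⟩
    rcases Finset.mem_insert.1 hx with rfl | hx' <;> rcases Finset.mem_insert.1 hy with rfl | hy'
    · exact absurd rfl hxy
    · exact hv y hy' p
    · simpa using hv x hx' p.reverse
    · exact hsep x hx' y hy' hxy p
  exact hvX (hX.2 hins (Finset.subset_insert v X) (Finset.mem_insert_self v X))

theorem nonempty_voronoiForest [Fintype W] (K : SimpleGraph W) (n : ℕ) :
    Nonempty (VoronoiForest K n) := by
  classical
  obtain ⟨X, hsep, hnet⟩ := exists_separated_net K n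
  have hex : ∀ v, ∃ m, ∃ x ∈ X, ∃ p : K.Walk v x, p.length = m := fun v => by
    obtain ⟨x, hx, p, -⟩ := hnet v
    exact ⟨_, x, hx, p, rfl⟩
  let d : W → ℕ := fun v => Nat.find (hex v)
  have hd_le : ∀ v, ∀ x ∈ X, ∀ p : K.Walk v x, d v ≤ p.length := fun v x hx p =>
    Nat.find_min' (hex v) ⟨x, hx, p, rfl⟩
  have hd_spec : ∀ v, ∃ x ∈ X, ∃ p : K.Walk v x, p.length = d v := fun v => Nat.find_spec (hex v)
  have hd_adj : ∀ u v, K.Adj u v → d v ≤ d u + 1 := fun u v huv => by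
    obtain ⟨x, hx, p, hp⟩ := hd_spec u
    simpa [hp] using hd_le v x hx (Walk.cons huv.symm p)
  have hd_mem : ∀ x ∈ X, d x = 0 := fun x hx => by simpa using hd_le x x hx Walk.nil
  have hpar : ∀ v, ∃ w, (v ∈ X → w = v) ∧ (v ∉ X → K.Adj v w ∧ d v = d w + 1) := fun v => by
    by_cases hv : v ∈ X
    · exact ⟨v, by simp [hv]⟩
    obtain ⟨x, hx, p, hp⟩ := hd_spec v
    cases p with
    | nil => exact absurd hx hv
    | @cons _ w _ h q =>
      refine ⟨w, fun h => absurd h hv, fun _ => ⟨h, ?_⟩⟩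
      have h1 := hd_le w x hx q
      have h2 := hd_adj w v h.symm
      simp only [Walk.length_cons] at hp
      omega
  choose par hpar_mem hpar_not using hpar
  refine ⟨⟨X, par, fun v => par^[d v] v, d, fun x hx => ?_, hd_mem, fun v hv => (hpar_not v hv).1,
    fun v hv => (hpar_not v hv).2, fun v hv => ?_, fun v => ?_, hd_adj, hsep⟩⟩
  · simp [hd_mem x hx]
  · simp only [(hpar_not v hv).2, Function.iterate_succ_apply]
  · obtain ⟨x, hx, p, hp⟩ := hnet v
    exact (hd_le v x hx p).trans hp

namespace VoronoiForest

variable {n : ℕ} (F : VoronoiForest K n)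

/-- The edges of the forest. -/
def treeEdges : Set (Sym2 W) := {e | ∃ w ∉ F.X, e = s(w, F.par w)}

theorem root_mem (v : W) : F.root v ∈ F.X := by
  induction hd : F.depth v generalizing v with
  | zero =>
    by_cases hv : v ∈ F.X
    · rwa [F.root_of_mem v hv]
    · have := F.depth_par v hv
      omega
  | succ m ih =>
    by_cases hv : v ∈ F.X
    · rwa [F.root_of_mem v hv]
    · rw [F.root_par v hv]
      exact ih _ (by have := F.depth_par v hv; omega)

theorem exists_walk_root (v : W) : ∃ p : K.Walk v (F.root v), p.length = F.depth v ∧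
    (∀ e ∈ p.edges, e ∈ F.treeEdges) ∧ ∀ w ∈ p.support, F.root w = F.root v := by
  induction hd : F.depth v generalizing v with
  | zero =>
    have hv : v ∈ F.X := by
      by_contra hv
      have := F.depth_par v hv
      omega
    exact ⟨Walk.nil.copy rfl (F.root_of_mem v hv).symm, by simp⟩
  | succ m ih =>
    have hv : v ∉ F.X := fun hv => by
      have := F.depth_of_mem v hv
      omega
    obtain ⟨p, hp, hpe, hps⟩ := ih (F.par v) (by have := F.depth_par v hv; omega)
    have hr := F.root_par v hv
    refine ⟨(Walk.cons (F.adj_par v hv) p).copy rfl hr.symm, by simp [hp], ?_, ?_⟩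
    · intro e he
      simp only [Walk.edges_copy, Walk.edges_cons, List.mem_cons] at he
      rcases he with rfl | he
      · exact ⟨v, hv, rfl⟩
      · exact hpe e he
    · intro w hw
      simp only [Walk.support_copy, Walk.support_cons, List.mem_cons] at hw
      rcases hw with rfl | hw
      · rfl
      · rw [hps w hw, hr]

/-- Two vertices of the same tree are joined by a walk in that tree. -/
theorem exists_walk_of_root_eq {u v : W} (h : F.root u = F.root v) :
    ∃ p : K.Walk u v, p.length = F.depth u + F.depth v ∧ ∀ e ∈ p.edges, e ∈ F.treeEdges := by
  obtain ⟨p, hp, hpe, -⟩ := F.exists_walk_root u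
  obtain ⟨q, hq, hqe, -⟩ := F.exists_walk_root v
  refine ⟨p.append (q.reverse.copy h.symm rfl), by simp [hp, hq], fun e he => ?_⟩
  simp only [Walk.edges_append, Walk.edges_copy, Walk.edges_reverse, List.mem_append,
    List.mem_reverse] at he
  exact he.elim (hpe e) (hqe e)

theorem root_eq_of_mem_treeEdges {u v : W} (h : s(u, v) ∈ F.treeEdges) :
    F.root u = F.root v := by
  obtain ⟨w, hw, he⟩ := h
  rcases Sym2.eq_iff.1 he with ⟨rfl, rfl⟩ | ⟨rfl, rfl⟩
  · exact F.root_par _ hw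
  · exact (F.root_par _ hw).symm

end VoronoiForest

/-- If `K` has large girth, then an edge lies on every short walk between its ends. -/
theorem SimpleGraph.mem_edges_of_length_lt {g : ℕ}
    (hg : ∀ v (p : K.Walk v v), p.IsCycle → g ≤ p.length) {u v : W} (huv : K.Adj u v)
    (p : K.Walk v u) (hp : p.length + 1 < g) : s(u, v) ∈ p.edges := by
  classical
  by_contra he
  have := hg u (Walk.cons huv p.bypass) ((Walk.cons_isCycle_iff _ _).2
    ⟨p.bypass_isPath, fun h => he (p.edges_bypass_subset_edges h)⟩)
  have := p.length_bypass_le_length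
  simp only [Walk.length_cons] at *
  omega

namespace VoronoiForest

variable {n : ℕ} (F : VoronoiForest K n)

theorem mem_treeEdges_of_root_eq
    (hg : ∀ v (p : K.Walk v v), p.IsCycle → 4 * n + 3 ≤ p.length) {u v : W} (huv : K.Adj u v)
    (h : F.root u = F.root v) : s(u, v) ∈ F.treeEdges := by
  obtain ⟨p, hp, hpe⟩ := F.exists_walk_of_root_eq h.symm
  have := F.depth_le u
  have := F.depth_le v
  exact hpe _ (mem_edges_of_length_lt hg huv p (by omega))

/-- Two trees are joined by at most one edge. -/
theorem eq_of_root_eq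
    (hg : ∀ v (p : K.Walk v v), p.IsCycle → 4 * n + 3 ≤ p.length) {u v u' v' : W}
    (huv : K.Adj u v) (huv' : K.Adj u' v') (hne : F.root u ≠ F.root v)
    (hu : F.root u = F.root u') (hv : F.root v = F.root v') : s(u, v) = s(u', v') := by
  obtain ⟨p, hp, hpe⟩ := F.exists_walk_of_root_eq hv
  obtain ⟨q, hq, hqe⟩ := F.exists_walk_of_root_eq hu.symm
  have := F.depth_le u
  have := F.depth_le v
  have := F.depth_le u'
  have := F.depth_le v'
  have hmem := mem_edges_of_length_lt hg huv (p.append (Walk.cons huv'.symm q))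
    (by simp [hp, hq]; omega)
  simp only [Walk.edges_append, Walk.edges_cons, List.mem_append, List.mem_cons] at hmem
  rcases hmem with h | h | h
  · exact absurd (F.root_eq_of_mem_treeEdges (hpe _ h)) hne
  · rw [h, Sym2.eq_swap]
  · exact absurd (F.root_eq_of_mem_treeEdges (hqe _ h)) hne

/-- Close to the roots there are only tree edges. -/
theorem mem_treeEdges_of_depth_lt
    (hg : ∀ v (p : K.Walk v v), p.IsCycle → 4 * n + 3 ≤ p.length) {u v : W} (huv : K.Adj u v)
    (h : F.depth u + F.depth v < n) : s(u, v) ∈ F.treeEdges := by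
  refine F.mem_treeEdges_of_root_eq hg huv ?_
  by_contra hne
  obtain ⟨p, hp, -⟩ := F.exists_walk_root u
  obtain ⟨q, hq, -⟩ := F.exists_walk_root v
  have := F.separated _ (F.root_mem u) _ (F.root_mem v) hne
    (p.reverse.append (Walk.cons huv q))
  simp only [Walk.length_append, Walk.length_reverse, Walk.length_cons] at this
  omega

end VoronoiForest

end VoronoiForest

section Counting

variable {W : Type u} [Fintype W] {K : SimpleGraph W}

/-- If every vertex of degree two has a neighbour of degree at least three, then the excess
degrees of the vertices in or next to `A` add up to at least `|A| / 4`. -/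
theorem SimpleGraph.card_add_le_sum_degree [DecidableRel K.Adj]
    (hdeg : ∀ v, 2 ≤ K.degree v)
    (hbr : ∀ b, K.degree b = 2 → ∃ a, K.Adj b a ∧ 3 ≤ K.degree a) {A B : Finset W}
    (hAB : A ⊆ B) (hN : ∀ a ∈ A, ∀ b, K.Adj a b → b ∈ B) :
    A.card + 8 * B.card ≤ 4 * ∑ v ∈ B, K.degree v := by
  classical
  have hφ : ∀ v, ∃ w, (w = v ∨ K.Adj v w) ∧ 3 ≤ K.degree w := fun v => by
    rcases (hdeg v).eq_or_lt with h | h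
    · obtain ⟨a, ha, ha'⟩ := hbr v h.symm
      exact ⟨a, Or.inr ha, ha'⟩
    · exact ⟨v, Or.inl rfl, h⟩
  choose φ hφ hφ3 using hφ
  have hmaps : Set.MapsTo φ A B := fun v hv => by
    rcases hφ v with h | h
    · rw [h]
      exact hAB hv
    · exact hN v hv _ h
  rw [Finset.card_eq_sum_card_fiberwise hmaps, Finset.mul_sum, Finset.card_eq_sum_ones,
    Finset.mul_sum, ← Finset.sum_add_distrib]
  refine Finset.sum_le_sum fun w _ => ?_
  by_cases hw : 3 ≤ K.degree w
  · have hsub : A.filter (fun v => φ v = w) ⊆ insert w (K.neighborFinset w) := fun v hv => by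
      obtain ⟨-, rfl⟩ := Finset.mem_filter.1 hv
      rcases hφ v with h | h
      · exact Finset.mem_insert.2 (Or.inl h.symm)
      · exact Finset.mem_insert_of_mem (by simpa using h.symm)
    have := (Finset.card_le_card hsub).trans (Finset.card_insert_le _ _)
    rw [card_neighborFinset_eq_degree] at this
    omega
  · have hempty : A.filter (fun v => φ v = w) = ∅ :=
      Finset.filter_eq_empty_iff.2 fun v _ h => hw (h ▸ hφ3 v)
    have := hdeg w
    rw [hempty, Finset.card_empty]
    omega

namespace VoronoiForest

variable {n : ℕ} (F : VoronoiForest K n)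

/-- The vertices of depth at most `i`. -/
def level (i : ℕ) : Finset W := Finset.univ.filter fun v => F.depth v ≤ i

theorem mem_level {i : ℕ} {v : W} : v ∈ F.level i ↔ F.depth v ≤ i := by simp [level]

theorem X_subset_level (i : ℕ) : F.X ⊆ F.level i := fun x hx =>
  F.mem_level.2 (by simp [F.depth_of_mem x hx])

theorem level_subset_succ (i : ℕ) : F.level i ⊆ F.level (i + 1) := fun _ hv =>
  F.mem_level.2 ((F.mem_level.1 hv).trans (Nat.le_succ i))

theorem sum_degree_level_le [DecidableRel K.Adj]
    (hg : ∀ v (p : K.Walk v v), p.IsCycle → 4 * n + 3 ≤ p.length) {i : ℕ} (hi : 2 * i + 1 < n) :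
    ∑ v ∈ F.level i, K.degree v + 2 * F.X.card ≤ (F.level i).card + (F.level (i + 1)).card := by
  let := Classical.decEq W
  have hle : ∀ v ∈ F.level i, K.degree v ≤ (if v ∈ F.X then 0 else 1) +
      ((F.level (i + 1) \ F.X).filter fun w => F.par w = v).card := fun v hv => by
    have hsub : K.neighborFinset v ⊆ (if v ∈ F.X then ∅ else {F.par v}) ∪
        (F.level (i + 1) \ F.X).filter fun w => F.par w = v := fun w hw => by
      have hvw : K.Adj v w := by simpa using hw
      have hdv := F.mem_level.1 hv
      have hdw := F.depth_adj v w hvw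
      obtain ⟨u, hu, he⟩ := F.mem_treeEdges_of_depth_lt hg hvw (by omega)
      rcases Sym2.eq_iff.1 he with ⟨rfl, rfl⟩ | ⟨rfl, rfl⟩
      · simp [hu]
      · refine Finset.mem_union_right _ (Finset.mem_filter.2 ⟨Finset.mem_sdiff.2 ⟨?_, hu⟩, rfl⟩)
        exact F.mem_level.2 (by omega)
    have := (Finset.card_le_card hsub).trans (Finset.card_union_le _ _)
    rw [card_neighborFinset_eq_degree] at this
    refine this.trans (Nat.add_le_add_right ?_ _)
    split_ifs <;> simp
  have hsum := Finset.sum_le_sum hle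
  rw [Finset.sum_add_distrib, Finset.sum_card_fiberwise_eq_card_filter] at hsum
  have h1 : ∑ v ∈ F.level i, (if v ∈ F.X then 0 else 1) = (F.level i \ F.X).card := by
    rw [Finset.card_eq_sum_ones, ← Finset.filter_notMem_eq_sdiff, Finset.sum_filter]
    simp only [ite_not]
  have h2 := Finset.card_filter_le (F.level (i + 1) \ F.X) fun w => F.par w ∈ F.level i
  have h3 := Finset.card_sdiff_add_card_eq_card (F.X_subset_level i)
  have h4 := Finset.card_sdiff_add_card_eq_card (F.X_subset_level (i + 1))
  omega

/-- Exponential growth of the neighbourhoods of the roots. -/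
theorem card_mul_pow_le_level [DecidableRel K.Adj]
    (hg : ∀ v (p : K.Walk v v), p.IsCycle → 4 * n + 3 ≤ p.length)
    (hdeg : ∀ v, 2 ≤ K.degree v)
    (hbr : ∀ b, K.degree b = 2 → ∃ a, K.Adj b a ∧ 3 ≤ K.degree a) (i : ℕ) (hi : 2 * i ≤ n) :
    (F.X.card : ℝ) * (6 / 5) ^ i ≤ 6 / 5 * (F.level i).card := by
  induction i using Nat.strong_induction_on with
  | _ i ih =>
    match i with
    | 0 =>
      have : (F.X.card : ℝ) ≤ (F.level 0).card := by
        exact_mod_cast Finset.card_le_card (F.X_subset_level 0)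
      have : (0 : ℝ) ≤ (F.level 0).card := by positivity
      linarith
    | 1 =>
      have : (F.X.card : ℝ) ≤ (F.level 1).card := by
        exact_mod_cast Finset.card_le_card (F.X_subset_level 1)
      linarith
    | i + 2 =>
      have h0 := ih i (by omega) (by omega)
      have h1 := ih (i + 1) (by omega) (by omega)
      have h2 := F.sum_degree_level_le hg (i := i + 1) (by omega)
      have h3 := card_add_le_sum_degree hdeg hbr (F.level_subset_succ i) fun a ha b hab =>
        F.mem_level.2 ((F.depth_adj a b hab).trans (Nat.succ_le_succ (F.mem_level.1 ha)))
      rw [show i + 1 + 1 = i + 2 from rfl] at h2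
      have h4 : ((F.level i).card : ℝ) + 4 * (F.level (i + 1)).card ≤
          4 * (F.level (i + 2)).card := by
        have : (F.level i).card + 4 * (F.level (i + 1)).card ≤ 4 * (F.level (i + 2)).card := by
          omega
        exact_mod_cast this
      have hX : 0 ≤ (F.X.card : ℝ) * (6 / 5) ^ i := by positivity
      rw [pow_succ] at h1 ⊢
      rw [pow_succ]
      linarith

/-- The minor obtained by contracting the trees. -/
def contraction {W : Type u} {K : SimpleGraph W} {n : ℕ} (F : VoronoiForest K n) :
    SimpleGraph (Fin F.X.card) :=
  SimpleGraph.fromRel fun i j => ∃ u v, K.Adj u v ∧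
    F.root u = F.X.equivFin.symm i ∧ F.root v = F.X.equivFin.symm j

theorem isShallowMinor_contraction {W : Type u} {K : SimpleGraph W} {n : ℕ}
    (F : VoronoiForest K n) : K.IsShallowMinor n F.contraction := by
  refine ⟨fun i => {v | F.root v = F.X.equivFin.symm i}, fun i j hij => ?_, fun i => ?_,
    fun i j hij => ?_⟩
  · refine Set.disjoint_left.2 fun v hi hj => hij ?_
    exact F.X.equivFin.symm.injective (Subtype.ext (hi.symm.trans hj))
  · refine ⟨⟨F.X.equivFin.symm i, F.root_of_mem _ (F.X.equivFin.symm i).2⟩, fun ⟨v, hv⟩ => ?_⟩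
    obtain ⟨p, hp, -, hps⟩ := F.exists_walk_root v
    have hv' : F.root v = F.X.equivFin.symm i := hv
    let q := (p.copy rfl hv').induce {v | F.root v = F.X.equivFin.symm i} fun x hx => by
      rw [Walk.support_copy] at hx
      exact (hps x hx).trans hv'
    refine ⟨q.reverse, ?_⟩
    rw [Walk.length_reverse, ← Walk.length_map (Embedding.induce _).toHom q, Walk.map_induce]
    simpa [hp] using F.depth_le v
  · rcases (SimpleGraph.fromRel_adj _ _ _).1 hij with ⟨-, ⟨u, v, h, hu, hv⟩ | ⟨u, v, h, hu, hv⟩⟩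
    · exact ⟨u, hu, v, hv, h⟩
    · exact ⟨v, hv, u, hu, h.symm⟩

theorem card_edges_contraction [DecidableRel K.Adj]
    (hg : ∀ v (p : K.Walk v v), p.IsCycle → 4 * n + 3 ≤ p.length) :
    K.edgeFinset.card + F.X.card ≤ Nat.card F.contraction.edgeSet + Fintype.card W := by
  classical
  let T : Finset (Sym2 W) := (Finset.univ \ F.X).image fun w => s(w, F.par w)
  have hT : T.card + F.X.card ≤ Fintype.card W := by
    have h1 : T.card ≤ _ := Finset.card_image_le
    have h2 := Finset.card_sdiff_add_card_eq_card (Finset.subset_univ F.X)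
    rw [Finset.card_univ] at h2
    omega
  have hroot : ∀ u v, K.Adj u v → s(u, v) ∉ T → F.root u ≠ F.root v := fun u v huv hT h => by
    obtain ⟨w, hw, he⟩ := F.mem_treeEdges_of_root_eq hg huv h
    exact hT (Finset.mem_image.2 ⟨w, by simpa using hw, he.symm⟩)
  let ψ : W → Fin F.X.card := fun v => F.X.equivFin ⟨F.root v, F.root_mem v⟩
  have hψ : ∀ u v, ψ u = ψ v → F.root u = F.root v := fun u v h => by
    simpa [ψ] using h
  have hcard : (K.edgeFinset \ T).card ≤ F.contraction.edgeFinset.card := by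
    refine Finset.card_le_card_of_injOn (Sym2.map ψ) ?_ ?_
    · intro e he
      induction e using Sym2.ind with
      | _ u v =>
        obtain ⟨he, heT⟩ := Finset.mem_sdiff.1 (Finset.mem_coe.1 he)
        have huv : K.Adj u v := by simpa using he
        have : F.contraction.Adj (ψ u) (ψ v) := (SimpleGraph.fromRel_adj _ _ _).2
          ⟨fun h => hroot u v huv heT (hψ u v h), Or.inl ⟨u, v, huv, by simp [ψ], by simp [ψ]⟩⟩
        simpa using this
    · intro e he e' he' hee'
      induction e using Sym2.ind with
      | _ u v =>
        induction e' using Sym2.ind with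
        | _ u' v' =>
          obtain ⟨he, heT⟩ := Finset.mem_sdiff.1 (Finset.mem_coe.1 he)
          obtain ⟨he', -⟩ := Finset.mem_sdiff.1 (Finset.mem_coe.1 he')
          have huv : K.Adj u v := by simpa using he
          have huv' : K.Adj u' v' := by simpa using he'
          have hne := hroot u v huv heT
          simp only [Sym2.map_mk] at hee'
          rcases Sym2.eq_iff.1 hee' with ⟨h1, h2⟩ | ⟨h1, h2⟩
          · exact F.eq_of_root_eq hg huv huv' hne (hψ _ _ h1) (hψ _ _ h2)
          · rw [Sym2.eq_swap (a := u')]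
            exact F.eq_of_root_eq hg huv huv'.symm hne (hψ _ _ h1) (hψ _ _ h2)
  have h3 := Finset.le_card_sdiff T K.edgeFinset
  rw [Nat.card_eq_fintype_card, ← SimpleGraph.edgeFinset_card]
  omega

end VoronoiForest

/-- A graph with minimum degree two and large girth in which every vertex of degree two has a
neighbour of degree at least three has a dense shallow minor. -/
theorem SimpleGraph.exists_dense_shallow_minor [Nonempty W] [DecidableRel K.Adj] (R : ℕ)
    (hg : ∀ v (p : K.Walk v v), p.IsCycle → 4 * (2 * R + 1) + 3 ≤ p.length)
    (hdeg : ∀ v, 2 ≤ K.degree v)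
    (hbr : ∀ b, K.degree b = 2 → ∃ a, K.Adj b a ∧ 3 ≤ K.degree a) :
    ∃ (h : ℕ) (H : SimpleGraph (Fin h)), 0 < h ∧ K.IsShallowMinor (2 * R + 1) H ∧
      (h : ℝ) * (5 / 48 * (6 / 5) ^ R) ≤ Nat.card H.edgeSet := by
  obtain ⟨F⟩ := nonempty_voronoiForest K (2 * R + 1)
  refine ⟨_, F.contraction, Finset.card_pos.2 ⟨_, F.root_mem (Classical.arbitrary W)⟩,
    F.isShallowMinor_contraction, ?_⟩
  have h1 := F.card_mul_pow_le_level hg hdeg hbr R (by omega)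
  have h2 : ((F.level R).card : ℝ) ≤ Fintype.card W := by
    exact_mod_cast Finset.card_le_univ _
  have h3 := F.card_edges_contraction hg
  have h4 := card_add_le_sum_degree hdeg hbr (Finset.subset_univ Finset.univ)
    fun _ _ b _ => Finset.mem_univ b
  rw [K.sum_degrees_eq_twice_card_edges, Finset.card_univ] at h4
  have h5 : (Fintype.card W : ℝ) ≤ 8 * Nat.card F.contraction.edgeSet := by
    have : Fintype.card W ≤ 8 * Nat.card F.contraction.edgeSet := by omega
    exact_mod_cast this
  linarith

end Counting

section Transfer

variable {V : Type u} {G : SimpleGraph V}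

theorem SimpleGraph.IsShallowMinor.of_induce_s4 {S : Set V} {r h : ℕ} {H : SimpleGraph (Fin h)}
    (hH : (G.induce S).IsShallowMinor r H) : G.IsShallowMinor r H := by
  obtain ⟨A, hdisj, hrad, hadj⟩ := hH
  refine ⟨fun i => Subtype.val '' A i, fun i j hij => ?_, fun i => ?_, fun i j hij => ?_⟩
  · exact Set.disjoint_image_of_injective Subtype.val_injective (hdisj hij)
  · obtain ⟨c, hc⟩ := hrad i
    refine ⟨⟨c, c, c.2, rfl⟩, ?_⟩
    rintro ⟨_, v, hv, rfl⟩
    obtain ⟨w, hw⟩ := hc ⟨v, hv⟩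
    let φ : (G.induce S).induce (A i) →g G.induce (Subtype.val '' A i) :=
      ⟨fun v => ⟨v, v, v.2, rfl⟩, fun h => h⟩
    exact ⟨w.map φ, (Walk.length_map φ w).trans_le hw⟩
  · obtain ⟨a, ha, b, hb, hab⟩ := hadj i j hij
    exact ⟨a, ⟨a, ha, rfl⟩, b, ⟨b, hb, rfl⟩, hab⟩

theorem SimpleGraph.le_length_of_isCycle_induce {S : Set V} {g : ℕ}
    (hg : ∀ v (p : G.Walk v v), p.IsCycle → g ≤ p.length) (v : S) (p : (G.induce S).Walk v v)
    (hp : p.IsCycle) : g ≤ p.length :=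
  (hg _ (p.map (Embedding.induce S).toHom)
    ((Walk.isCycle_map_iff_of_injective Subtype.val_injective).2 hp)).trans_eq
      (Walk.length_map _ p)

theorem SimpleGraph.degree_induce_coe [Fintype V] [DecidableRel G.Adj] (S : Finset V)
    [DecidableRel (G.induce (S : Set V)).Adj] (v : (S : Set V)) :
    (G.induce (S : Set V)).degree v = (S.filter fun w => G.Adj v w).card := by
  classical
  rw [← card_neighborFinset_eq_degree]
  refine Finset.card_bij (fun w _ => w) ?_ ?_ ?_
  · intro w hw
    have : G.Adj v w := by simpa using hw
    exact Finset.mem_filter.2 ⟨w.2, this⟩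
  · intro w _ w' _ h
    exact Subtype.ext h
  · intro w hw
    obtain ⟨hw, hvw⟩ := Finset.mem_filter.1 hw
    exact ⟨⟨w, hw⟩, by simpa using hvw, rfl⟩

end Transfer

section Colouring

theorem circulantDigraph_five_two (i j : ZMod 5) :
    circulantDigraph 5 2 i j ↔ j - i = 1 ∨ j - i = 2 := by
  constructor
  · rintro ⟨s, h1, h2, h⟩
    interval_cases s
    · exact Or.inl (by simpa using h)
    · exact Or.inr (by simpa using h)
  · rintro (h | h)
    · exact ⟨1, le_rfl, one_le_two, by simpa using h⟩
    · exact ⟨2, one_le_two, le_rfl, by simpa using h⟩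

theorem circulantDigraph_five_two_irrefl (i : ZMod 5) : ¬ circulantDigraph 5 2 i i := by
  rw [circulantDigraph_five_two]
  revert i
  decide

variable {V : Type u} {o : V → V → Prop}

/-- The colours `i` of `u` and `j` of `v` are compatible with the arcs between `u` and `v`. -/
def Compatible (o : V → V → Prop) (u v : V) (i j : ZMod 5) : Prop :=
  (o u v → circulantDigraph 5 2 i j) ∧ (o v u → circulantDigraph 5 2 j i)

theorem Compatible.symm {u v : V} {i j : ZMod 5} (h : Compatible o u v i j) :
    Compatible o v u j i := And.symm h

/-- Adjacency in the tournament `C⃗_5^2`, forwards or backwards. -/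
def stepRel (s : Bool) (i j : ZMod 5) : Bool :=
  if s then (j - i = 1 ∨ j - i = 2) else (i - j = 1 ∨ i - j = 2)

theorem exists_stepRel : ∀ (s : Bool) (i : ZMod 5), ∃ j, stepRel s i j := by decide

theorem exists_stepRel_four : ∀ (s t s' t' : Bool) (i j : ZMod 5), ∃ α, stepRel s i α ∧
    ∃ β, stepRel t α β ∧ ∃ γ, stepRel s' β γ ∧ stepRel t' γ j := by
  decide +kernel

theorem exists_compatible_of_stepRel (ho : ∀ u v, o u v → ¬ o v u) (u v : V) :
    ∃ s, ∀ i j, stepRel s i j → Compatible o u v i j := by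
  by_cases h : o u v
  · refine ⟨true, fun i j hij => ⟨fun _ => ?_, fun h' => absurd h' (ho u v h)⟩⟩
    rw [circulantDigraph_five_two]
    simpa [stepRel] using hij
  · refine ⟨false, fun i j hij => ⟨fun h' => absurd h' h, fun _ => ?_⟩⟩
    rw [circulantDigraph_five_two]
    simpa [stepRel] using hij

theorem exists_compatible (ho : ∀ u v, o u v → ¬ o v u) (u v : V) (i : ZMod 5) :
    ∃ j, Compatible o u v i j := by
  obtain ⟨s, hs⟩ := exists_compatible_of_stepRel ho u v
  obtain ⟨j, hj⟩ := exists_stepRel s i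
  exact ⟨j, hs i j hj⟩

/-- The ends of an oriented path of length four may be coloured arbitrarily. -/
theorem exists_compatible_four (ho : ∀ u v, o u v → ¬ o v u) (x a b c y : V) (i j : ZMod 5) :
    ∃ α β γ, Compatible o x a i α ∧ Compatible o a b α β ∧ Compatible o b c β γ ∧
      Compatible o c y γ j := by
  obtain ⟨s, hs⟩ := exists_compatible_of_stepRel ho x a
  obtain ⟨t, ht⟩ := exists_compatible_of_stepRel ho a b
  obtain ⟨s', hs'⟩ := exists_compatible_of_stepRel ho b c
  obtain ⟨t', ht'⟩ := exists_compatible_of_stepRel ho c y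
  obtain ⟨α, h1, β, h2, γ, h3, h4⟩ := exists_stepRel_four s t s' t' i j
  exact ⟨α, β, γ, hs _ _ h1, ht _ _ h2, hs' _ _ h3, ht' _ _ h4⟩

/-- `f` is a homomorphism to `C⃗_5^2` on the sub-digraph induced by `S`. -/
def IsHomOn (o : V → V → Prop) (S : Finset V) (f : V → ZMod 5) : Prop :=
  ∀ u ∈ S, ∀ v ∈ S, Compatible o u v (f u) (f v)

variable {G : SimpleGraph V}

theorem compatible_of_not_adj (ho : G.IsOrientation o) {u v : V} (h : ¬ G.Adj u v)
    (i j : ZMod 5) : Compatible o u v i j :=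
  ⟨fun h' => absurd (ho.1 _ _ h') h, fun h' => absurd (ho.1 _ _ h').symm h⟩

theorem SimpleGraph.IsOrientation.asymm (ho : G.IsOrientation o) (u v : V) (h : o u v) :
    ¬ o v u :=
  (ho.2 u v (ho.1 u v h)).1 h

variable [DecidableEq V] {S : Finset V}

theorem IsHomOn.extend_leaf (ho : G.IsOrientation o) {v w : V}
    (hw : ∀ u ∈ S, G.Adj v u → u = w) {f : V → ZMod 5} (hf : IsHomOn o (S.erase v) f) :
    ∃ f', IsHomOn o S f' := by
  obtain ⟨j, hj⟩ := exists_compatible ho.asymm w v (f w)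
  have key : ∀ u ∈ S, u ≠ v → Compatible o v u j (f u) := fun u hu huv => by
    by_cases h : G.Adj v u
    · rw [hw u hu h]
      exact hj.symm
    · exact compatible_of_not_adj ho h _ _
  refine ⟨Function.update f v j, fun a ha b hb => ?_⟩
  by_cases hav : a = v <;> by_cases hbv : b = v
  · subst hav hbv
    exact compatible_of_not_adj ho (G.irrefl) _ _
  · subst hav
    simpa [hbv] using key b hb hbv
  · subst hbv
    simpa [hav] using (key a ha hav).symm
  · simpa [hav, hbv] using
      hf a (Finset.mem_erase.2 ⟨hav, ha⟩) b (Finset.mem_erase.2 ⟨hbv, hb⟩)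

theorem IsHomOn.extend_path (ho : G.IsOrientation o) {x a b c y : V} (hac : ¬ G.Adj a c)
    (hab : a ≠ b) (hbc : b ≠ c) (hne : a ≠ c)
    (ha : ∀ u ∈ S, G.Adj a u → u = b ∨ u = x) (hb : ∀ u ∈ S, G.Adj b u → u = a ∨ u = c)
    (hc : ∀ u ∈ S, G.Adj c u → u = b ∨ u = y) {f : V → ZMod 5}
    (hf : IsHomOn o (S \ {a, b, c}) f) : ∃ f', IsHomOn o S f' := by
  obtain ⟨α, β, γ, h1, h2, h3, h4⟩ := exists_compatible_four ho.asymm x a b c y (f x) (f y)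
  have hself : ∀ u i j, Compatible o u u i j := fun u => compatible_of_not_adj ho G.irrefl
  have keya : ∀ u ∈ S, u ≠ b → Compatible o a u α (f u) := fun u hu hub => by
    by_cases h : G.Adj a u
    · rw [(ha u hu h).resolve_left hub]
      exact h1.symm
    · exact compatible_of_not_adj ho h _ _
  have keyb : ∀ u ∈ S, u ≠ a → u ≠ c → Compatible o b u β (f u) := fun u hu hua huc =>
    compatible_of_not_adj ho (fun h => (hb u hu h).elim hua huc) _ _
  have keyc : ∀ u ∈ S, u ≠ b → Compatible o c u γ (f u) := fun u hu hub => by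
    by_cases h : G.Adj c u
    · rw [(hc u hu h).resolve_left hub]
      exact h4
    · exact compatible_of_not_adj ho h _ _
  have h5 : Compatible o a c α γ := compatible_of_not_adj ho hac _ _
  let f' : V → ZMod 5 := fun u => if u = a then α else if u = b then β else if u = c then γ else f u
  have fa : f' a = α := by simp [f']
  have fb : f' b = β := by simp [f', hab.symm]
  have fc : f' c = γ := by simp [f', hbc.symm, hne.symm]
  have fu : ∀ u, u ≠ a → u ≠ b → u ≠ c → f' u = f u := fun u h h' h'' => by simp [f', h, h', h'']
  have hcase : ∀ u, u = a ∨ u = b ∨ u = c ∨ (u ≠ a ∧ u ≠ b ∧ u ≠ c) := fun u => by tauto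
  refine ⟨f', fun u hu v hv => ?_⟩
  rcases hcase u with rfl | rfl | rfl | ⟨ua, ub, uc⟩ <;>
    rcases hcase v with rfl | rfl | rfl | ⟨va, vb, vc⟩
  · exact hself _ _ _
  · rwa [fa, fb]
  · rwa [fa, fc]
  · rw [fa, fu v va vb vc]
    exact keya v hv vb
  · rw [fa, fb]
    exact h2.symm
  · exact hself _ _ _
  · rwa [fb, fc]
  · rw [fb, fu v va vb vc]
    exact keyb v hv va vc
  · rw [fa, fc]
    exact h5.symm
  · rw [fb, fc]
    exact h3.symm
  · exact hself _ _ _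
  · rw [fc, fu v va vb vc]
    exact keyc v hv vb
  · rw [fa, fu u ua ub uc]
    exact (keya u hu ub).symm
  · rw [fb, fu u ua ub uc]
    exact (keyb u hu ua uc).symm
  · rw [fc, fu u ua ub uc]
    exact (keyc u hu ub).symm
  · rw [fu u ua ub uc, fu v va vb vc]
    exact hf u (by simp [hu, ua, ub, uc]) v (by simp [hv, va, vb, vc])

/-- Graphs of large girth without dense shallow minors have the homomorphism property. -/
theorem exists_isHomOn [Fintype V] (R : ℕ)
    (hg : ∀ v (p : G.Walk v v), p.IsCycle → 4 * (2 * R + 1) + 3 ≤ p.length)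
    (hsparse : ∀ (h : ℕ) (H : SimpleGraph (Fin h)), 0 < h → G.IsShallowMinor (2 * R + 1) H →
      (Nat.card H.edgeSet : ℝ) < h * (5 / 48 * (6 / 5) ^ R))
    (ho : G.IsOrientation o) (S : Finset V) : ∃ f, IsHomOn o S f := by
  classical
  induction S using Finset.strongInduction with
  | H S ih =>
  rcases S.eq_empty_or_nonempty with rfl | hne
  · exact ⟨0, by simp [IsHomOn]⟩
  by_cases hleaf : ∃ v ∈ S, (S.filter fun w => G.Adj v w).card < 2
  · obtain ⟨v, hv, hcard⟩ := hleaf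
    obtain ⟨f, hf⟩ := ih _ (Finset.erase_ssubset hv)
    have : Nonempty V := ⟨v⟩
    obtain ⟨w, hw⟩ := Finset.card_le_one_iff_subset_singleton.1 (Nat.lt_succ_iff.1 hcard)
    exact hf.extend_leaf ho (w := w) fun u hu huv =>
      Finset.mem_singleton.1 (hw (Finset.mem_filter.2 ⟨hu, huv⟩))
  by_cases hpath : ∃ a ∈ S, ∃ b ∈ S, ∃ c ∈ S, a ≠ c ∧ G.Adj b a ∧ G.Adj b c ∧
      (S.filter fun w => G.Adj a w).card = 2 ∧ (S.filter fun w => G.Adj b w).card = 2 ∧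
      (S.filter fun w => G.Adj c w).card = 2
  · obtain ⟨a, ha, b, hb, c, hc, hac, hba, hbc, hda, hdb, hdc⟩ := hpath
    have hnb : ∀ v, (S.filter fun w => G.Adj v w).card = 2 → ∀ w ∈ S, G.Adj v w →
        ∃ x, ∀ u ∈ S, G.Adj v u → u = w ∨ u = x := fun v hv w hw hvw => by
      obtain ⟨p, q, -, hpq⟩ := Finset.card_eq_two.1 hv
      have hmem : ∀ u, u ∈ S → G.Adj v u → u = p ∨ u = q := fun u hu hvu => by
        have : u ∈ S.filter fun w => G.Adj v w := Finset.mem_filter.2 ⟨hu, hvu⟩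
        simpa [hpq] using this
      rcases hmem w hw hvw with rfl | rfl
      · exact ⟨q, hmem⟩
      · exact ⟨p, fun u hu hvu => (hmem u hu hvu).symm⟩
    obtain ⟨x, hx⟩ := hnb a hda b hb hba.symm
    obtain ⟨y, hy⟩ := hnb c hdc b hb hbc.symm
    obtain ⟨z, hz⟩ := hnb b hdb a ha hba
    obtain rfl : c = z := (hz c hc hbc).resolve_left hac.symm
    have hadj : ¬ G.Adj a c := fun h => by
      have := mem_edges_of_length_lt hg h (Walk.cons hbc.symm (Walk.cons hba Walk.nil))
        (by simp)
      simp [hac, hac.symm, hba.ne', hbc.ne'] at this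
    obtain ⟨f, hf⟩ := ih (S \ {a, b, c}) (Finset.sdiff_ssubset (by
      simp [Finset.insert_subset_iff, ha, hb, hc]) ⟨a, by simp⟩)
    exact hf.extend_path ho hadj hba.ne' hbc.ne hac hx hz hy
  · exfalso
    push Not at hleaf hpath
    have : Nonempty (S : Set V) := hne.to_subtype
    obtain ⟨h, H, hpos, hH, hcard⟩ := exists_dense_shallow_minor (K := G.induce (S : Set V)) R
      (fun v p hp => le_length_of_isCycle_induce hg v p hp)
      (fun v => by
        rw [degree_induce_coe]
        exact hleaf v v.2)
      (fun b hb => by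
        by_contra! hlt
        rw [degree_induce_coe] at hb
        obtain ⟨a, c, hac, heq⟩ := Finset.card_eq_two.1 hb
        have hmem : ∀ w, w = a ∨ w = c → w ∈ S ∧ G.Adj b w ∧
            (S.filter fun u => G.Adj w u).card = 2 := fun w hw => by
          have hw' : w ∈ S.filter fun w => G.Adj b w := by simpa [heq] using hw
          obtain ⟨hwS, hbw⟩ := Finset.mem_filter.1 hw'
          have h1 := hlt ⟨w, hwS⟩ hbw
          rw [degree_induce_coe] at h1
          exact ⟨hwS, hbw, le_antisymm (Nat.lt_succ_iff.1 h1) (hleaf w hwS)⟩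
        obtain ⟨haS, hba, hda⟩ := hmem a (Or.inl rfl)
        obtain ⟨hcS, hbc, hdc⟩ := hmem c (Or.inr rfl)
        exact hpath a haS b b.2 c hcS hac hba hbc hda hb hdc)
    exact absurd hcard (not_le.2 (hsparse h H hpos hH.of_induce_s4))

end Colouring

theorem tendsto_const_mul_pow_div_exp :
    Filter.Tendsto (fun R : ℕ => 5 / 48 * (6 / 5 : ℝ) ^ R / Real.exp (3 / 50 * (2 * R + 1)))
      Filter.atTop Filter.atTop := by
  have hlog : Real.exp (3 / 25) < 6 / 5 := by
    have := Real.exp_bound_div_one_sub_of_interval (x := 3 / 25) (by norm_num) (by norm_num)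
    linarith
  have hone : 1 < 6 / 5 / Real.exp (3 / 25) := (one_lt_div (Real.exp_pos _)).2 hlog
  refine ((tendsto_pow_atTop_atTop_of_one_lt hone).const_mul_atTop
    (show (0 : ℝ) < 5 / 48 / Real.exp (3 / 50) by positivity)).congr fun R => ?_
  rw [show (3 / 50 * (2 * (R : ℝ) + 1)) = 3 / 50 + R * (3 / 25) by ring, Real.exp_add,
    Real.exp_nat_mul, div_pow]
  field_simp

/-- Exponential upper bound on the expansion at some arbitrarily large depth. -/
theorem GraphClass.exists_expansion_lt (C : GraphClass)
    (h : Filter.limsup (fun r : ℕ => ENNReal.log (C.expansion r) / (r : EReal)) Filter.atTop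
      ≤ ((1 / 20 : ℝ) : EReal)) :
    ∃ R : ℕ, C.expansion (2 * R + 1) < ENNReal.ofReal (5 / 48 * (6 / 5) ^ R) := by
  have hev := Filter.eventually_lt_of_limsup_lt
    (h.trans_lt (EReal.coe_lt_coe_iff.2 (show (1 / 20 : ℝ) < 3 / 50 by norm_num)))
  have hev' : ∀ᶠ R : ℕ in Filter.atTop, ENNReal.log (C.expansion (2 * R + 1)) /
      ((2 * R + 1 : ℕ) : EReal) < ((3 / 50 : ℝ) : EReal) :=
    (Filter.tendsto_atTop_mono (fun R : ℕ => (by omega : R ≤ 2 * R + 1))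
      Filter.tendsto_id).eventually hev
  obtain ⟨R, h1, h2⟩ :=
    (hev'.and (tendsto_const_mul_pow_div_exp.eventually_ge_atTop 1)).exists
  refine ⟨R, lt_of_lt_of_le ?_ (ENNReal.ofReal_le_ofReal ((one_le_div (Real.exp_pos _)).1 h2))⟩
  rw [EReal.div_lt_iff (by exact_mod_cast Nat.succ_pos _) (EReal.natCast_ne_top _)] at h1
  rw [← ENNReal.log_lt_log_iff, ENNReal.log_ofReal, if_neg (not_le.2 (Real.exp_pos _)),
    Real.log_exp]
  refine h1.trans_le (le_of_eq ?_)
  push_cast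
  norm_cast

theorem oriented_chromatic_of_large_girth_limsup
    (C : GraphClass)
    (h : Filter.limsup
        (fun r : ℕ => ENNReal.log (C.expansion r) / (r : EReal)) Filter.atTop
      ≤ ((1 / 20 : ℝ) : EReal)) :
    ∃ g : ℕ, ∀ G ∈ C, (g : ℕ∞) ≤ (Sigma.snd G).egirth →
      (Sigma.snd G).orientedChromNum ≤ 5 ∧
      ∀ o : Fin G.1 → Fin G.1 → Prop, (Sigma.snd G).IsOrientation o →
        ∃ f : Fin G.1 → ZMod 5, ∀ u v, o u v → circulantDigraph 5 2 (f u) (f v) := by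

  obtain ⟨R, hR⟩ := C.exists_expansion_lt h
  refine ⟨4 * (2 * R + 1) + 3, ?_⟩
  rintro ⟨n, G⟩ hGC hgirth
  have hg : ∀ v (p : G.Walk v v), p.IsCycle → 4 * (2 * R + 1) + 3 ≤ p.length :=
    fun v p hp => by exact_mod_cast le_egirth.1 hgirth v p hp
  have hsparse : ∀ (h : ℕ) (H : SimpleGraph (Fin h)), 0 < h → G.IsShallowMinor (2 * R + 1) H →
      (Nat.card H.edgeSet : ℝ) < h * (5 / 48 * (6 / 5) ^ R) := fun h H hpos hH => by
    have h1 : (Nat.card H.edgeSet : ℝ≥0∞) / (h : ℝ≥0∞) ≤ C.expansion (2 * R + 1) :=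
      (le_sSup ⟨h, H, hpos, hH, rfl⟩ : _ ≤ G.nabla (2 * R + 1)).trans
        (le_sSup ⟨⟨n, G⟩, hGC, rfl⟩)
    have hpos' : (0 : ℝ) < h := by exact_mod_cast hpos
    have h2 := h1.trans_lt hR
    rw [← ENNReal.ofReal_natCast, ← ENNReal.ofReal_natCast, ← ENNReal.ofReal_div_of_pos hpos',
      ENNReal.ofReal_lt_ofReal_iff (by positivity), div_lt_iff₀ hpos'] at h2
    linarith
  have hom : ∀ o : Fin n → Fin n → Prop, G.IsOrientation o →
      ∃ f : Fin n → ZMod 5, ∀ u v, o u v → circulantDigraph 5 2 (f u) (f v) := fun o ho => by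
    obtain ⟨f, hf⟩ := exists_isHomOn R hg hsparse ho Finset.univ
    exact ⟨f, fun u v huv => (hf u (Finset.mem_univ u) v (Finset.mem_univ v)).1 huv⟩
  exact ⟨Nat.sInf_le fun o ho =>
    ⟨circulantDigraph 5 2, circulantDigraph_five_two_irrefl, hom o ho⟩, hom⟩
end

section
/- Let G be a finite simple graph and let p be a positive integer. If G is 2p-path degenerate, then G admits a p-centered coloring with at most p + 1 colors. -/
open SimpleGraph ENNReal

universe u

namespace SimpleGraph

variable {V : Type*}

/-- Color the vertices of `M` with `p` and every other vertex with its depth modulo `p`. -/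
noncomputable def layerColor (p : ℕ) (M : Set V) (d : V → ℕ) (v : V) : ℕ :=
  open Classical in if v ∈ M then p else d v % p

theorem layerColor_of_mem {p : ℕ} {M : Set V} {d : V → ℕ} {v : V} (h : v ∈ M) :
    layerColor p M d v = p := if_pos h

theorem layerColor_of_notMem {p : ℕ} {M : Set V} {d : V → ℕ} {v : V} (h : v ∉ M) :
    layerColor p M d v = d v % p := if_neg h

/-- `d` is the depth function of a rooted forest on the complement of `M`, and any walk joining
two distinct vertices of `M` meets at least `p` colors of `layerColor p M d`. -/
structure IsCenteredLayering (G : SimpleGraph V) (p : ℕ) (M : Set V) (d : V → ℕ) : Prop where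
  adj : ∀ u v, G.Adj u v → u ∉ M → v ∉ M → d u = d v + 1 ∨ d v = d u + 1
  parent_unique : ∀ u v w, G.Adj v u → G.Adj v w → u ∉ M → v ∉ M → w ∉ M →
    d v = d u + 1 → d v = d w + 1 → u = w
  many_colors : ∀ u ∈ M, ∀ v ∈ M, u ≠ v → ∀ w : G.Walk u v,
    p ≤ (layerColor p M d '' {x | x ∈ w.support}).ncard

theorem IsAcyclic.eq_of_dist_eq_dist_add_one {G : SimpleGraph V} (hG : G.IsAcyclic)
    {r u v w : V} (hr : G.Reachable r v) (hu : G.Adj v u) (hw : G.Adj v w)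
    (hdu : G.dist r v = G.dist r u + 1) (hdw : G.dist r v = G.dist r w + 1) : u = w := by
  obtain ⟨a, -, ha⟩ := (hr.trans hu.reachable).exists_path_of_dist
  obtain ⟨b, -, hb⟩ := (hr.trans hw.reachable).exists_path_of_dist
  have hau : (a.concat hu.symm).IsPath :=
    Walk.isPath_of_length_eq_dist _ (by rw [Walk.length_concat, ha, hdu])
  have hbw : (b.concat hw.symm).IsPath :=
    Walk.isPath_of_length_eq_dist _ (by rw [Walk.length_concat, hb, hdw])
  have h := congrArg (fun q : G.Path r v => q.1.penultimate) ((hG.subsingleton_path r v).elim ⟨_, hau⟩ ⟨_, hbw⟩)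
  simpa using h

theorem Subgraph.exists_isCenteredLayering {G : SimpleGraph V} (H : G.Subgraph)
    (hH : H.coe.IsAcyclic) (p : ℕ) : ∃ M d, H.spanningCoe.IsCenteredLayering p M d := by
  classical
  let r : H.verts → H.verts := fun v => (H.coe.connectedComponentMk v).out
  have hr : ∀ v, H.coe.Reachable (r v) v := fun v => ConnectedComponent.exact (Quot.out_eq _)
  have hrr : ∀ u v, H.coe.Adj u v → r u = r v := fun u v h =>
    congrArg Quot.out (ConnectedComponent.sound h.reachable)
  refine ⟨∅, fun v => if h : v ∈ H.verts then H.coe.dist (r ⟨v, h⟩) ⟨v, h⟩ else 0, ?_, ?_, ?_⟩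
  · intro u v (huv : H.Adj u v) _ _
    have hu := huv.fst_mem
    have hv := huv.snd_mem
    have hadj : H.coe.Adj ⟨u, hu⟩ ⟨v, hv⟩ := huv
    simp only [dif_pos hu, dif_pos hv, ← hrr _ _ hadj]
    exact hH.dist_eq_dist_add_one_of_adj_of_reachable _ hadj (hr _)
  · intro u v w (hvu : H.Adj v u) (hvw : H.Adj v w) _ _ _
    have hu := hvu.snd_mem
    have hv := hvu.fst_mem
    have hw := hvw.snd_mem
    have hu' : H.coe.Adj ⟨v, hv⟩ ⟨u, hu⟩ := hvu
    have hw' : H.coe.Adj ⟨v, hv⟩ ⟨w, hw⟩ := hvw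
    simp only [dif_pos hu, dif_pos hv, dif_pos hw, ← hrr _ _ hu', ← hrr _ _ hw']
    intro h₁ h₂
    exact congrArg Subtype.val (hH.eq_of_dist_eq_dist_add_one (hr _) hu' hw' h₁ h₂)
  · intro u hu
    exact hu.elim

theorem _root_.Set.le_ncard_of_injOn_range {α : Type*} {T : Set α} (hT : T.Finite) {n : ℕ}
    {g : ℕ → α} (hg : Set.InjOn g (Finset.range n)) (hgT : ∀ j < n, g j ∈ T) : n ≤ T.ncard := by
  classical
  have hsub : ((Finset.range n).image g : Set α) ⊆ T := by
    intro c hc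
    simp only [Finset.coe_image, Finset.coe_range, Set.mem_image, Set.mem_Iio] at hc
    obtain ⟨j, hj, rfl⟩ := hc
    exact hgT j hj
  calc n = ((Finset.range n).image g).card := by
        rw [Finset.card_image_of_injOn hg, Finset.card_range]
    _ = ((Finset.range n).image g : Set α).ncard := (Set.ncard_coe_finset _).symm
    _ ≤ _ := Set.ncard_le_ncard hsub hT

theorem le_ncard_layerColor_image {p : ℕ} {M : Set V} {d : V → ℕ} {S : Set V} (hS : S.Finite)
    {x : V} (hxS : x ∈ S) (hxM : x ∈ M) (b : ℕ)
    (h : ∀ j, 0 < j → j < p → ∃ y ∈ S, y ∉ M ∧ d y = b + j) :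
    p ≤ (layerColor p M d '' S).ncard := by
  rcases Nat.eq_zero_or_pos p with rfl | hp
  · exact Nat.zero_le _
  let g : ℕ → ℕ := fun j => if j = 0 then p else (b + j) % p
  have hg : Set.InjOn g (Finset.range p) := by
    intro i hi j hj hij
    simp only [Finset.coe_range, Set.mem_Iio] at hi hj
    have hlt : ∀ k, (b + k) % p < p := fun k => Nat.mod_lt _ hp
    by_cases hi0 : i = 0 <;> by_cases hj0 : j = 0
    · omega
    · have := hlt j
      simp only [g, hi0, hj0, if_true, if_false] at hij
      omega
    · have := hlt i
      simp only [g, hi0, hj0, if_true, if_false] at hij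
      omega
    · simp only [g, hi0, hj0, if_false] at hij
      exact (Nat.ModEq.add_left_cancel' b hij).eq_of_lt_of_lt hi hj
  refine Set.le_ncard_of_injOn_range (hS.image _) hg fun j hj => ?_
  by_cases hj0 : j = 0
  · exact ⟨x, hxS, by simp [g, hj0, layerColor_of_mem hxM]⟩
  · obtain ⟨y, hyS, hyM, hy⟩ := h j (Nat.pos_of_ne_zero hj0) hj
    exact ⟨y, hyS, by simp [g, hj0, layerColor_of_notMem hyM, hy]⟩

theorem IsCenteredLayering.exists_unique_or_le_ncard {G : SimpleGraph V} {p : ℕ} (hp : 0 < p)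
    {M : Set V} {d : V → ℕ} (h : G.IsCenteredLayering p M d) {S : Set V} (hS : S.Finite)
    (hconn : (G.induce S).Connected) :
    (∃ x ∈ S, ∀ y ∈ S, layerColor p M d y = layerColor p M d x → y = x) ∨
      p ≤ (layerColor p M d '' S).ncard := by
  have hlt : ∀ v, v ∉ M → layerColor p M d v < p := fun v hv => by
    rw [layerColor_of_notMem hv]; exact Nat.mod_lt _ hp
  by_cases hM : ∃ x ∈ S, x ∈ M
  · obtain ⟨x, hxS, hxM⟩ := hM
    by_cases hM2 : ∃ y ∈ S, y ∈ M ∧ x ≠ y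
    · obtain ⟨y, hyS, hyM, hxy⟩ := hM2
      right
      obtain ⟨w⟩ := hconn.preconnected ⟨x, hxS⟩ ⟨y, hyS⟩
      refine (h.many_colors x hxM y hyM hxy (w.map (Embedding.induce S).toHom)).trans
        (Set.ncard_le_ncard (Set.image_mono ?_) (hS.image _))
      intro z hz
      obtain ⟨z', -, rfl⟩ := List.mem_map.1
        ((congrArg (z ∈ ·) (Walk.support_map (Embedding.induce S).toHom w)).mp hz)
      exact z'.2
    · left
      refine ⟨x, hxS, fun y hyS hy => ?_⟩
      by_contra hne
      have hyM : y ∉ M := fun hyM => hM2 ⟨y, hyS, hyM, fun e => hne e.symm⟩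
      have := hlt y hyM
      rw [hy, layerColor_of_mem hxM] at this
      exact lt_irrefl _ this
  · push Not at hM
    obtain ⟨⟨r₀, hr₀⟩⟩ := hconn.nonempty
    obtain ⟨r, hrS, hr⟩ := Set.exists_min_image S d hS ⟨r₀, hr₀⟩
    let R : V → V → Prop := fun u v => G.Adj u v ∧ v ∈ S ∧ u ∈ S ∧ d v = d u + 1
    have hdesc : ∀ v : S, Relation.ReflTransGen R r v := by
      intro v
      have hreach := hconn.preconnected ⟨r, hrS⟩ v
      rw [reachable_iff_reflTransGen] at hreach
      induction hreach with
      | refl => exact .refl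
      | @tail b c _ hbc ih =>
        have hbc : G.Adj b c := hbc
        rcases h.adj b c hbc (hM _ b.2) (hM _ c.2) with hd | hd
        · rcases Relation.ReflTransGen.cases_tail ih with heq | ⟨u, hu, hub⟩
          · have := hr c c.2
            rw [heq] at hd
            omega
          · rwa [← h.parent_unique u b c hub.1.symm hbc (hM _ hub.2.2.1) (hM _ b.2) (hM _ c.2)
              hub.2.2.2 hd]
        · exact ih.tail ⟨hbc, c.2, b.2, hd⟩
    have hlevels : ∀ v, Relation.ReflTransGen R r v → (d r ≤ d v ∧ (d v = d r → v = r)) ∧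
        ∀ k, d r ≤ k → k ≤ d v → ∃ y ∈ S, d y = k := by
      intro v hv
      induction hv with
      | refl => exact ⟨⟨le_rfl, fun _ => rfl⟩, fun k h₁ h₂ => ⟨r, hrS, le_antisymm h₁ h₂⟩⟩
      | @tail b c _ hbc ih =>
        obtain ⟨-, hcS, -, hd⟩ := hbc
        refine ⟨⟨by omega, fun _ => by omega⟩, fun k h₁ h₂ => ?_⟩
        rcases Nat.lt_or_ge (d b) k with hk | hk
        · exact ⟨c, hcS, by omega⟩
        · exact ih.2 k h₁ hk
    by_cases hall : ∀ y ∈ S, layerColor p M d y = layerColor p M d r → y = r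
    · exact .inl ⟨r, hrS, hall⟩
    · right
      push Not at hall
      obtain ⟨y, hyS, hcol, hne⟩ := hall
      rw [layerColor_of_notMem (hM _ hyS), layerColor_of_notMem (hM _ hrS)] at hcol
      obtain ⟨⟨hle, heq⟩, hlev⟩ := hlevels y (hdesc ⟨y, hyS⟩)
      have hfar : d r + p ≤ d y := by
        have hdvd := (Nat.modEq_iff_dvd' hle).1 (show d r ≡ d y [MOD p] from hcol.symm)
        have := Nat.le_of_dvd (by have := mt heq hne; omega) hdvd
        omega
      let g : ℕ → ℕ := fun j => (d r + j) % p
      have hg : Set.InjOn g (Finset.range p) := by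
        intro i hi j hj hij
        simp only [Finset.coe_range, Set.mem_Iio] at hi hj
        exact (Nat.ModEq.add_left_cancel' (d r) hij).eq_of_lt_of_lt hi hj
      refine Set.le_ncard_of_injOn_range (hS.image _) hg fun j hj => ?_
      obtain ⟨z, hzS, hz⟩ := hlev (d r + j) (by omega) (by omega)
      exact ⟨z, hzS, by rw [layerColor_of_notMem (hM _ hzS), hz]⟩

/-- The first `N + 1` values of `f` are the vertices of a path in `G` whose internal vertices
have no neighbors off the path. -/
structure IsThread (G : SimpleGraph V) (N : ℕ) (f : ℕ → V) : Prop where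
  injOn : Set.InjOn f {i | i ≤ N}
  eq_or_eq : ∀ i v, 0 < i → i < N → G.Adj (f i) v → v = f (i - 1) ∨ v = f (i + 1)

/-- The internal vertices of a thread. -/
def threadInterior (N : ℕ) (f : ℕ → V) : Set V := {v | ∃ i, 0 < i ∧ i < N ∧ v = f i}

namespace IsThread

variable {G : SimpleGraph V} {N : ℕ} {f : ℕ → V}

theorem notMem_interior (hf : G.IsThread N f) : f 0 ∉ threadInterior N f ∧
    f N ∉ threadInterior N f := by
  constructor
  · rintro ⟨i, h0, hN, h⟩
    have := hf.injOn (show 0 ≤ N by omega) (show i ≤ N by omega) h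
    omega
  · rintro ⟨i, h0, hN, h⟩
    have := hf.injOn (show N ≤ N by omega) (show i ≤ N by omega) h
    omega

/-- A walk that leaves the interior of a thread traverses one of the two sides. -/
theorem support_of_walk (hf : G.IsThread N f) {x y : V} (w : G.Walk x y)
    (hy : y ∉ threadInterior N f) (i : ℕ) (h0 : 0 < i) (hN : i < N) (hx : x = f i) :
    (∀ j, 0 < j → j ≤ i → f j ∈ w.support) ∨ (∀ j, i ≤ j → j < N → f j ∈ w.support) := by
  induction w generalizing i with
  | nil => exact absurd ⟨i, h0, hN, hx⟩ hy
  | @cons x x' y hadj w ih =>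
    subst hx
    simp only [Walk.support_cons, List.mem_cons]
    rcases hf.eq_or_eq i x' h0 hN hadj with h | h
    · by_cases hi : i = 1
      · exact .inl fun j _ _ => .inl (by congr 1; omega)
      · rcases ih hy (i - 1) (by omega) (by omega) h with h' | h'
        · refine .inl fun j hj hji => ?_
          rcases Nat.lt_or_ge j i with hlt | hge
          · exact .inr (h' j hj (by omega))
          · exact .inl (by congr 1; omega)
        · exact .inr fun j hj hjN => .inr (h' j (by omega) hjN)
    · by_cases hi : i + 1 = N
      · exact .inr fun j _ _ => .inl (by congr 1; omega)
      · rcases ih hy (i + 1) (by omega) (by omega) h with h' | h'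
        · exact .inl fun j hj hji => .inr (h' j hj (by omega))
        · refine .inr fun j hj hjN => ?_
          rcases Nat.lt_or_ge i j with hlt | hge
          · exact .inr (h' j (by omega) hjN)
          · exact .inl (by congr 1; omega)

/-- A walk avoiding one internal vertex of a thread can be retracted off the interior. -/
theorem exists_walk_off_interior (hf : G.IsThread N f) {G' : SimpleGraph V}
    (hG' : ∀ u v, G.Adj u v → u ∉ threadInterior N f → v ∉ threadInterior N f → G'.Adj u v)
    {m : ℕ} (hm0 : 0 < m) (hmN : m < N) {x y : V} (w : G.Walk x y)
    (hy : y ∉ threadInterior N f) (hm : f m ∉ w.support) :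
    ∃ x', (x ∉ threadInterior N f → x' = x) ∧ (∀ i, 0 < i → i < m → x = f i → x' = f 0) ∧
      (∀ i, m < i → i < N → x = f i → x' = f N) ∧
      ∃ w' : G'.Walk x' y, ∀ z ∈ w'.support, z ∈ w.support ∧ z ∉ threadInterior N f := by
  have hinj : ∀ {i j}, i ≤ N → j ≤ N → f i = f j → i = j := fun hi hj h => hf.injOn hi hj h
  induction w with
  | @nil x =>
    refine ⟨x, fun _ => rfl, fun i h0 hi hx => (hy ⟨i, h0, by omega, hx⟩).elim,
      fun i h0 hi hx => (hy ⟨i, by omega, by omega, hx⟩).elim, .nil, ?_⟩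
    simpa using hy
  | @cons x x' y hadj w ih =>
    simp only [Walk.support_cons, List.mem_cons, not_or] at hm
    obtain ⟨r, hr, hrl, hrr, w', hw'⟩ := ih hy hm.2
    have hx'm : x' ≠ f m := fun h => hm.2 (h ▸ w.start_mem_support)
    have hsupp : ∀ z ∈ w'.support, z ∈ (Walk.cons hadj w).support ∧ z ∉ threadInterior N f :=
      fun z hz => ⟨by simp [(hw' z hz).1], (hw' z hz).2⟩
    by_cases hx : x ∈ threadInterior N f
    · obtain ⟨i, hi0, hiN, rfl⟩ := hx
      have him : i ≠ m := fun h => hm.1 (h ▸ rfl)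
      refine ⟨r, fun h => (h ⟨i, hi0, hiN, rfl⟩).elim, fun k hk0 hkm hk => ?_,
        fun k hkm hkN hk => ?_, w', hsupp⟩
      · obtain rfl := hinj (by omega) (by omega) hk
        rcases hf.eq_or_eq i x' hi0 hiN hadj with h | h
        · by_cases hi : i = 1
          · subst hi
            rw [h] at hr
            rw [hr hf.notMem_interior.1]
          · exact hrl (i - 1) (by omega) (by omega) h
        · have : i + 1 ≠ m := fun e => hx'm (e ▸ h)
          exact hrl (i + 1) (by omega) (by omega) h
      · obtain rfl := hinj (by omega) (by omega) hk
        rcases hf.eq_or_eq i x' hi0 hiN hadj with h | h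
        · have : i - 1 ≠ m := fun e => hx'm (e ▸ h)
          exact hrr (i - 1) (by omega) (by omega) h
        · by_cases hi : i + 1 = N
          · rw [hi] at h
            rw [h] at hr
            rw [hr hf.notMem_interior.2]
          · exact hrr (i + 1) (by omega) (by omega) h
    · refine ⟨x, fun _ => rfl, fun i h0 hi h => (hx ⟨i, h0, by omega, h⟩).elim,
        fun i h0 hi h => (hx ⟨i, by omega, by omega, h⟩).elim, ?_⟩
      by_cases hx' : x' ∈ threadInterior N f
      · obtain ⟨i, hi0, hiN, rfl⟩ := hx'
        have him : i ≠ m := fun h => hx'm (h ▸ rfl)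
        have hrx : r = x := by
          rcases hf.eq_or_eq i x hi0 hiN hadj.symm with h | h
          · have : i = 1 := by
              by_contra hi
              exact hx ⟨i - 1, by omega, by omega, h⟩
            subst this
            rw [hrl 1 hi0 (by omega) rfl, h]
          · have hiN' : i + 1 = N := by
              by_contra hi
              exact hx ⟨i + 1, by omega, by omega, h⟩
            rw [hrr i (by omega) hiN rfl, h, hiN']
        subst hrx
        exact ⟨w', hsupp⟩
      · obtain rfl := hr hx'
        refine ⟨.cons (hG' _ _ hadj hx hx') w', fun z hz => ?_⟩
        rw [Walk.support_cons, List.mem_cons] at hz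
        rcases hz with rfl | hz
        · exact ⟨by simp, hx⟩
        · exact hsupp z hz

theorem exists_isCenteredLayering (hf : G.IsThread N f) {p : ℕ} (hp : 0 < p) (hN : 2 * p ≤ N)
    {G' : SimpleGraph V}
    (hG' : ∀ u v, G.Adj u v → u ∉ threadInterior N f → v ∉ threadInterior N f → G'.Adj u v)
    {M : Set V} {d : V → ℕ} (h : G'.IsCenteredLayering p M d) :
    ∃ M d, G.IsCenteredLayering p M d := by
  classical
  set I := threadInterior N f with hI
  have hinj : ∀ {i j}, i ≤ N → j ≤ N → f i = f j → i = j := fun hi hj h => hf.injOn hi hj h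
  have hmemI : ∀ i, 0 < i → i < N → f i ∈ I := fun i h0 h1 => ⟨i, h0, h1, rfl⟩
  let e : ℕ → ℕ := fun i => if i < p then d (f 0) + i else d (f N) + (N - i)
  obtain ⟨d', hdI, hdO⟩ : ∃ d' : V → ℕ, (∀ i, i ≤ N → d' (f i) = e i) ∧
      ∀ v, v ∉ I → d' v = d v := by
    refine ⟨fun v => if v ∈ I then e (Function.invFunOn f {i | i ≤ N} v) else d v, ?_, ?_⟩
    · intro i hi
      by_cases hiI : f i ∈ I
      · simp only [if_pos hiI]
        rw [hf.injOn.leftInvOn_invFunOn hi]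
      · simp only [if_neg hiI]
        by_cases h0 : i = 0
        · subst h0; simp [e, hp]
        · by_cases h1 : i = N
          · subst h1; simp [e, show ¬ i < p by omega]
          · exact (hiI (hmemI i (by omega) (by omega))).elim
    · intro v hv
      simp only [if_neg hv]
  have hpN : p < N := by omega
  have hpI : f p ∈ I := hmemI p hp hpN
  let M' : Set V := (M \ I) ∪ {f p}
  have hpM' : f p ∈ M' := .inr rfl
  have hM'O : ∀ v, v ∉ I → (v ∈ M' ↔ v ∈ M) := by
    intro v hv
    refine ⟨?_, fun hm => .inl ⟨hm, hv⟩⟩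
    rintro (hm | rfl)
    · exact hm.1
    · exact (hv hpI).elim
  have hM'I : ∀ i, 0 < i → i < N → i ≠ p → f i ∉ M' := by
    rintro i h0 h1 hip (hm | hm)
    · exact hm.2 (hmemI i h0 h1)
    · exact hip (hinj (by omega) (by omega) hm)
  have hnbr : ∀ i v, 0 < i → i < N → i ≠ p → G.Adj (f i) v → v ∉ M' →
      (i < p → (v = f (i - 1) ∧ d' (f i) = d' v + 1) ∨ (v = f (i + 1) ∧ d' v = d' (f i) + 1)) ∧
      (p < i → (v = f (i + 1) ∧ d' (f i) = d' v + 1) ∨ (v = f (i - 1) ∧ d' v = d' (f i) + 1)) := by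
    intro i v h0 h1 hip hadj hv
    have hne : v ≠ f p := fun e => hv (e ▸ hpM')
    have hd₀ := hdI (i - 1) (by omega)
    have hd₁ := hdI i (by omega)
    have hd₂ := hdI (i + 1) (by omega)
    rcases hf.eq_or_eq i v h0 h1 hadj with rfl | rfl
    · have hip' : i - 1 ≠ p := fun e => hne (congrArg f e)
      constructor <;> intro hlt
      · refine .inl ⟨rfl, ?_⟩
        rw [hd₀, hd₁]; simp only [e]; split_ifs <;> omega
      · refine .inr ⟨rfl, ?_⟩
        rw [hd₀, hd₁]; simp only [e]; split_ifs <;> omega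
    · have hip' : i + 1 ≠ p := fun e => hne (congrArg f e)
      constructor <;> intro hlt
      · refine .inr ⟨rfl, ?_⟩
        rw [hd₂, hd₁]; simp only [e]; split_ifs <;> omega
      · refine .inl ⟨rfl, ?_⟩
        rw [hd₂, hd₁]; simp only [e]; split_ifs <;> omega
  have hnotI : ∀ u v, G.Adj v u → u ∈ I → v ∉ I → u ∉ M' → v ∉ M' → d' u = d' v + 1 := by
    rintro _ v hadj ⟨i, h0, h1, rfl⟩ hvI hu hv
    have hip : i ≠ p := fun e => hu (e ▸ hpM')
    obtain ⟨hl, hr⟩ := hnbr i v h0 h1 hip hadj.symm hv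
    rcases Nat.lt_or_gt_of_ne hip with hlt | hgt
    · rcases hl hlt with h' | h'
      · exact h'.2
      · exact (hvI (h'.1 ▸ hmemI (i + 1) (by omega) (by omega))).elim
    · rcases hr hgt with h' | h'
      · exact h'.2
      · exact (hvI (h'.1 ▸ hmemI (i - 1) (by omega) (by omega))).elim
  refine ⟨M', d', ?_, ?_, ?_⟩
  · intro u v hadj hu hv
    by_cases huI : u ∈ I
    · obtain ⟨i, h0, h1, rfl⟩ := huI
      have hip : i ≠ p := fun e => hu (e ▸ hpM')
      obtain ⟨hl, hr⟩ := hnbr i v h0 h1 hip hadj hv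
      rcases Nat.lt_or_gt_of_ne hip with hlt | hgt
      · exact (hl hlt).imp And.right And.right
      · exact (hr hgt).imp And.right And.right
    · by_cases hvI : v ∈ I
      · exact .inr (hnotI v u hadj hvI huI hv hu)
      · rw [hdO u huI, hdO v hvI]
        exact h.adj u v (hG' u v hadj huI hvI) (mt (hM'O u huI).2 hu) (mt (hM'O v hvI).2 hv)
  · intro u v w hvu hvw hu hv hw hdu hdw
    by_cases hvI : v ∈ I
    · obtain ⟨i, h0, h1, rfl⟩ := hvI
      have hip : i ≠ p := fun e => hv (e ▸ hpM')
      obtain ⟨hl, hr⟩ := hnbr i u h0 h1 hip hvu hu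
      obtain ⟨hl', hr'⟩ := hnbr i w h0 h1 hip hvw hw
      rcases Nat.lt_or_gt_of_ne hip with hlt | hgt
      · rcases hl hlt with h₁ | h₁ <;> rcases hl' hlt with h₂ | h₂ <;>
          first | omega | exact h₁.1.trans h₂.1.symm
      · rcases hr hgt with h₁ | h₁ <;> rcases hr' hgt with h₂ | h₂ <;>
          first | omega | exact h₁.1.trans h₂.1.symm
    · have huI : u ∉ I := fun huI => by
        have := hnotI u v hvu huI hvI hu hv
        omega
      have hwI : w ∉ I := fun hwI => by
        have := hnotI w v hvw hwI hvI hw hv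
        omega
      rw [hdO v hvI] at hdu hdw
      rw [hdO u huI] at hdu
      rw [hdO w hwI] at hdw
      exact h.parent_unique u v w (hG' v u hvu hvI huI) (hG' v w hvw hvI hwI)
        (mt (hM'O u huI).2 hu) (mt (hM'O v hvI).2 hv) (mt (hM'O w hwI).2 hw) hdu hdw
  · have hside : ∀ v, v ∉ I → ∀ w : G.Walk (f p) v, ∀ S : Set V, S.Finite →
        (∀ x ∈ w.support, x ∈ S) → p ≤ (layerColor p M' d' '' S).ncard := by
      intro v hvI w S hS hwS
      rcases hf.support_of_walk w hvI p hp hpN rfl with hl | hr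
      · refine le_ncard_layerColor_image hS (hwS _ w.start_mem_support) hpM' (d (f 0))
          fun j h0 hj => ⟨f j, hwS _ (hl j h0 hj.le), hM'I j h0 (by omega) (by omega), ?_⟩
        rw [hdI j (by omega)]
        simp [e, hj]
      · refine le_ncard_layerColor_image hS (hwS _ w.start_mem_support) hpM' (d (f N))
          fun j h0 hj => ⟨f (N - j), hwS _ (hr (N - j) (by omega) (by omega)),
            hM'I _ (by omega) (by omega) (by omega), ?_⟩
        rw [hdI _ (by omega)]
        simp only [e, show ¬ N - j < p by omega, if_false]
        omega
    have hoff : ∀ v ∈ M', v ≠ f p → v ∉ I ∧ v ∈ M := by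
      rintro v (hv | hv) hne
      · exact ⟨hv.2, hv.1⟩
      · exact (hne hv).elim
    intro u hu v hv huv w
    have hfin : {x | x ∈ w.support}.Finite := List.finite_toSet _
    by_cases hpw : f p ∈ w.support
    · by_cases hvp : v = f p
      · subst hvp
        exact hside u (hoff u hu huv).1 w.reverse _ hfin (by simp)
      · exact hside v (hoff v hv hvp).1 (w.dropUntil _ hpw) _ hfin
          fun x hx => w.support_dropUntil_subset_support hpw hx
    · obtain ⟨huI, huM⟩ := hoff u hu fun e => hpw (e ▸ w.start_mem_support)
      obtain ⟨hvI, hvM⟩ := hoff v hv fun e => hpw (e ▸ w.end_mem_support)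
      obtain ⟨x', hx', -, -, w', hw'⟩ := hf.exists_walk_off_interior hG' hp hpN w hvI hpw
      obtain rfl := hx' huI
      refine (h.many_colors _ huM v hvM huv w').trans (Set.ncard_le_ncard ?_ (hfin.image _))
      rintro _ ⟨z, hz, rfl⟩
      obtain ⟨hzw, hzI⟩ := hw' z hz
      refine ⟨z, hzw, ?_⟩
      by_cases hzM : z ∈ M
      · rw [layerColor_of_mem hzM, layerColor_of_mem ((hM'O z hzI).2 hzM)]
      · rw [layerColor_of_notMem hzM, layerColor_of_notMem (mt (hM'O z hzI).1 hzM), hdO z hzI]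

end IsThread

theorem _root_.List.mem_tail_dropLast_iff {α : Type*} {l : List α} {x a : α} :
    x ∈ l.tail.dropLast ↔ x ∈ threadInterior (l.length - 1) (fun i => l.getD i a) := by
  rw [List.mem_iff_getElem]
  constructor
  · rintro ⟨i, hi, rfl⟩
    simp only [List.length_dropLast, List.length_tail] at hi
    refine ⟨i + 1, by omega, by omega, ?_⟩
    simp [List.getElem_dropLast, List.getElem_tail, show i + 1 < l.length by omega]
  · rintro ⟨i, h0, h1, rfl⟩
    refine ⟨i - 1, by simp; omega, ?_⟩
    simp [List.getElem_dropLast, List.getElem_tail, show i < l.length by omega,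
      show i - 1 + 1 = i by omega]

theorem Subgraph.isThread_of_isChain {G : SimpleGraph V} (H : G.Subgraph) {l : List V}
    (hnd : l.Nodup) (hchain : l.IsChain H.Adj)
    (hdeg : ∀ v ∈ l.tail.dropLast, (H.neighborSet v).ncard = 2) (hl : l ≠ []) (a : V) :
    H.spanningCoe.IsThread (l.length - 1) (fun i => l.getD i a) := by
  have hpos := List.length_pos_of_ne_nil hl
  have hinj : Set.InjOn (fun i => l.getD i a) {i | i ≤ l.length - 1} := by
    intro i hi j hj hij
    simp only [Set.mem_ofPred_eq] at hi hj
    simp only [List.getD_eq_getElem _ _ (show i < l.length by omega),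
      List.getD_eq_getElem _ _ (show j < l.length by omega)] at hij
    exact (hnd.getElem_inj_iff).1 hij
  refine ⟨hinj, fun i v h0 h1 hadj => ?_⟩
  have hstep : ∀ j, j + 1 < l.length → H.Adj (l.getD j a) (l.getD (j + 1) a) := by
    intro j hj
    rw [List.getD_eq_getElem _ _ (show j < l.length by omega), List.getD_eq_getElem _ _ hj]
    exact List.isChain_iff_getElem.1 hchain j hj
  have hcard := hdeg (l.getD i a) (List.mem_tail_dropLast_iff.2 ⟨i, h0, h1, rfl⟩)
  have hprev : H.Adj (l.getD i a) (l.getD (i - 1) a) := by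
    have := (hstep (i - 1) (by omega)).symm
    rwa [show i - 1 + 1 = i by omega] at this
  have hne : l.getD (i - 1) a ≠ l.getD (i + 1) a := fun h => by
    have := hinj (show i - 1 ≤ l.length - 1 by omega) (show i + 1 ≤ l.length - 1 by omega) h
    omega
  have hsub : ({l.getD (i - 1) a, l.getD (i + 1) a} : Set V) ⊆ H.neighborSet (l.getD i a) := by
    rintro x (rfl | rfl)
    · exact hprev
    · exact hstep i (by omega)
  have heq := Set.eq_of_subset_of_ncard_le hsub (by rw [hcard, Set.ncard_pair hne])
    (Set.finite_of_ncard_ne_zero (by omega))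
  have hv : v ∈ H.neighborSet (l.getD i a) := hadj
  rw [← heq] at hv
  exact hv

theorem PathDegen.exists_isCenteredLayering {V : Type u} {G : SimpleGraph V} {p : ℕ} (hp : 0 < p)
    {H : G.Subgraph} (h : G.PathDegen (2 * p) H) :
    ∃ M d, H.spanningCoe.IsCenteredLayering p M d := by
  induction h with
  | forest H hH => exact H.exists_isCenteredLayering hH p
  | step H l hnd hchain hlen hdeg _ ih =>
    obtain ⟨M, d, hMd⟩ := ih
    have hl : l ≠ [] := by rintro rfl; simp at hlen
    have hf := H.isThread_of_isChain hnd hchain hdeg hl (l.head hl)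
    refine hf.exists_isCenteredLayering hp (by omega) (fun u v hadj hu hv => ?_) hMd
    rw [← List.mem_tail_dropLast_iff] at hu hv
    have hadj' : H.Adj u v := hadj
    simp [hadj', hu, hv, hadj'.fst_mem, hadj'.snd_mem]

end SimpleGraph

theorem centered_coloring_of_path_degenerate
    {V : Type} [Fintype V] (G : SimpleGraph V) (p : ℕ) (hp : 0 < p)
    (h : G.IsPathDegenerate (2 * p)) :
    ∃ c : V → Fin (p + 1), G.IsCenteredColoring p c := by
  obtain ⟨M, d, hMd⟩ := PathDegen.exists_isCenteredLayering hp h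
  rw [Subgraph.spanningCoe_top] at hMd
  have hlt : ∀ v, layerColor p M d v < p + 1 := fun v => by
    by_cases hv : v ∈ M
    · simp [layerColor_of_mem hv]
    · rw [layerColor_of_notMem hv]
      exact (Nat.mod_lt _ hp).trans (Nat.lt_succ_self p)
  refine ⟨fun v => ⟨layerColor p M d v, hlt v⟩, fun s hs => ?_⟩
  rcases hMd.exists_unique_or_le_ncard hp s.toFinite hs with ⟨x, hxs, hx⟩ | hle
  · refine .inl ⟨⟨layerColor p M d x, hlt x⟩, Set.ncard_eq_one.2 ⟨x, ?_⟩⟩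
    ext y
    simp only [Fin.mk.injEq, Set.mem_ofPred_eq, Set.mem_singleton_iff]
    exact ⟨fun hy => hx y hy.1 hy.2, fun hy => by subst hy; exact ⟨hxs, rfl⟩⟩
  · right
    rw [← Set.ncard_image_of_injective _ Fin.val_injective, Set.image_image]
    exact hle
end
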